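/- arXiv:1309.6604 — 5 statements merged into one kernel-verified Lean document; each statement's English description precedes it below -/
import Mathlib

section
/- (Riemann-sum representations of the planar mixed Young integral.) Let γ_1, γ_2 > 1/2, let x : [0,1]^2 → ℝ be continuous with N_{γ_1,γ_2}(x) < ∞, let φ ∈ C^2(ℝ,ℝ), and set y = φ∘x. Then for every rectangle [s_1,s_2] × [t_1,t_2] ⊆ [0,1]^2 and every sequence of grid partitions with mesh tending to 0, the three Riemann sums Σ_{i,j} y(σ_i,τ_j) δ_1 x_{σ_i σ_{i+1};τ_j} δ_2 x_{σ_{i+1};τ_j τ_{j+1}}, Σ_{i,j} y(σ_i,τ_j) δ_2 x_{σ_i;τ_j τ_{j+1}} δ_1 x_{σ_i σ_{i+1};τ_{j+1}}, and Σ_{i,j} y(σ_i,τ_j) δ_1 x_{σ_i σ_{i+1};τ_j} δ_2 x_{σ_i;τ_j τ_{j+1}} all converge, and they converge to the same limit z^{2,y}_{s_1 s_2;t_1 t_2}. Moreover the Riemann sums Σ_{i,j} y(σ_i,τ_j) δx_{σ_i σ_{i+1};τ_j τ_{j+1}} also converge as the mesh tends to 0. -/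
open Set Filter
open scoped ENNReal Topology

noncomputable section

def I01 : Set ℝ := Set.Icc 0 1

/-- Rectangular increment of a two-parameter function. -/
def dRect (f : ℝ → ℝ → ℝ) (s1 s2 t1 t2 : ℝ) : ℝ :=
  f s2 t2 - f s1 t2 - f s2 t1 + f s1 t1

/-- Increment in the first direction. -/
def d1 (f : ℝ → ℝ → ℝ) (s1 s2 t : ℝ) : ℝ := f s2 t - f s1 t

/-- Increment in the second direction. -/
def d2 (f : ℝ → ℝ → ℝ) (s t1 t2 : ℝ) : ℝ := f s t2 - f s t1

/-- Two-parameter Hölder seminorm of the rectangular increments. -/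
noncomputable def holRect (a1 a2 : ℝ) (f : ℝ → ℝ → ℝ) : ℝ≥0∞ :=
  ⨆ (s1 : I01) (s2 : I01) (t1 : I01) (t2 : I01),
    ENNReal.ofReal (|dRect f (s1 : ℝ) (s2 : ℝ) (t1 : ℝ) (t2 : ℝ)| /
      (|(s2 : ℝ) - (s1 : ℝ)| ^ a1 * |(t2 : ℝ) - (t1 : ℝ)| ^ a2))

/-- Hölder seminorm in the first direction. -/
noncomputable def hol1 (a1 : ℝ) (f : ℝ → ℝ → ℝ) : ℝ≥0∞ :=
  ⨆ (s1 : I01) (s2 : I01) (t : I01),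
    ENNReal.ofReal (|d1 f (s1 : ℝ) (s2 : ℝ) (t : ℝ)| / |(s2 : ℝ) - (s1 : ℝ)| ^ a1)

/-- Hölder seminorm in the second direction. -/
noncomputable def hol2 (a2 : ℝ) (f : ℝ → ℝ → ℝ) : ℝ≥0∞ :=
  ⨆ (s : I01) (t1 : I01) (t2 : I01),
    ENNReal.ofReal (|d2 f (s : ℝ) (t1 : ℝ) (t2 : ℝ)| / |(t2 : ℝ) - (t1 : ℝ)| ^ a2)

/-- Supremum norm on the unit square. -/
noncomputable def holInf (f : ℝ → ℝ → ℝ) : ℝ≥0∞ :=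
  ⨆ (s : I01) (t : I01), ENNReal.ofReal |f (s : ℝ) (t : ℝ)|

/-- The norm `N_{a1,a2}`. -/
noncomputable def NN (a1 a2 : ℝ) (f : ℝ → ℝ → ℝ) : ℝ≥0∞ :=
  holRect a1 a2 f + hol1 a1 f + hol2 a2 f + holInf f

/-- A sequence of partitions of `[a,b]` whose mesh tends to `0`. -/
def IsPartSeq (a b : ℝ) (m : ℕ → ℕ) (σ : ℕ → ℕ → ℝ) : Prop :=
  (∀ n, σ n 0 = a) ∧ (∀ n, σ n (m n) = b) ∧
  (∀ n, ∀ i < m n, σ n i < σ n (i + 1)) ∧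
  ∀ ε : ℝ, 0 < ε → ∃ N : ℕ, ∀ n ≥ N, ∀ i < m n, σ n (i + 1) - σ n i < ε


lemma sewing_one {G : ℝ → ℝ → ℝ} {C θ K : ℝ} (hθ : 1 < θ) (hC : 0 ≤ C) (hK : 0 ≤ K)
    (hK2 : 2 + 2 * K * (1 / 2 : ℝ) ^ θ ≤ K)
    (hG : ∀ s u s', s ≤ u → u ≤ s' → |G s s' - G s u - G u s'| ≤ C * (s' - s) ^ θ)
    {σ : ℕ → ℝ} (hσ : Monotone σ) :
    ∀ n i j : ℕ, i ≤ j → j - i ≤ n →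
      |∑ k ∈ Finset.Ico i j, G (σ k) (σ (k + 1)) - G (σ i) (σ j)| ≤ K * C * (σ j - σ i) ^ θ := by
  have h0 : ∀ a, G a a = 0 := by
    intro a
    have := hG a a a le_rfl le_rfl
    rw [sub_self a, Real.zero_rpow (by linarith), mul_zero, sub_self, zero_sub, abs_neg] at this
    exact abs_nonpos_iff.mp this
  intro n
  induction n with
  | zero =>
    intro i j hij hn
    obtain rfl : i = j := by omega
    rw [Finset.Ico_self, Finset.sum_empty, h0, sub_self, sub_self, abs_zero,
      Real.zero_rpow (by linarith), mul_zero]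
  | succ n ih =>
    intro i j hij hn
    rcases hij.eq_or_lt with rfl | hlt
    · rw [Finset.Ico_self, Finset.sum_empty, h0, sub_self, sub_self, abs_zero,
        Real.zero_rpow (by linarith), mul_zero]
    have hmid : ∃ k, i ≤ k ∧ k < j ∧ σ k ≤ (σ i + σ j) / 2 ∧ (σ i + σ j) / 2 ≤ σ (k + 1) := by
      have hL : σ i ≤ σ j := hσ hij
      have hex : ∃ l, (σ i + σ j) / 2 ≤ σ (i + l + 1) := by
        refine ⟨j - i - 1, ?_⟩
        rw [show i + (j - i - 1) + 1 = j by omega]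
        linarith
      classical
      have hf := Nat.find_spec hex
      have hmin : Nat.find hex ≤ j - i - 1 := by
        apply Nat.find_min'
        rw [show i + (j - i - 1) + 1 = j by omega]
        linarith
      refine ⟨i + Nat.find hex, by omega, by omega, ?_, hf⟩
      rcases Nat.eq_zero_or_pos (Nat.find hex) with h | h
      · rw [h, add_zero]; linarith
      · have := Nat.find_min hex (m := Nat.find hex - 1) (by omega)
        rw [show i + (Nat.find hex - 1) + 1 = i + Nat.find hex by omega] at this
        linarith
    obtain ⟨k, hik, hkj, hk1, hk2⟩ := hmid
    have e1 := ih i k hik (by omega)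
    have e2 := ih (k + 1) j (by omega) (by omega)
    have hik' : σ i ≤ σ k := hσ hik
    have hkk' : σ k ≤ σ (k + 1) := hσ (by omega)
    have hkj' : σ (k + 1) ≤ σ j := hσ (by omega)
    have g1 := hG (σ i) (σ k) (σ j) hik' (by linarith)
    have g2 := hG (σ k) (σ (k + 1)) (σ j) hkk' hkj'
    have g2' : C * (σ j - σ k) ^ θ ≤ C * (σ j - σ i) ^ θ := by
      apply mul_le_mul_of_nonneg_left _ hC
      exact Real.rpow_le_rpow (by linarith) (by linarith) (by linarith)
    have hhalf : ((σ j - σ i) * (1 / 2)) ^ θ = (σ j - σ i) ^ θ * (1 / 2 : ℝ) ^ θ :=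
      Real.mul_rpow (by linarith) (by norm_num)
    have r1 : (σ k - σ i) ^ θ ≤ (σ j - σ i) ^ θ * (1 / 2 : ℝ) ^ θ := by
      rw [← hhalf]; exact Real.rpow_le_rpow (by linarith) (by linarith) (by linarith)
    have r2 : (σ j - σ (k + 1)) ^ θ ≤ (σ j - σ i) ^ θ * (1 / 2 : ℝ) ^ θ := by
      rw [← hhalf]; exact Real.rpow_le_rpow (by linarith) (by linarith) (by linarith)
    have r1' := mul_le_mul_of_nonneg_left r1 (mul_nonneg hK hC)
    have r2' := mul_le_mul_of_nonneg_left r2 (mul_nonneg hK hC)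
    have hX : 0 ≤ C * (σ j - σ i) ^ θ := mul_nonneg hC (Real.rpow_nonneg (by linarith) _)
    have hfin := mul_le_mul_of_nonneg_right hK2 hX
    rw [← Finset.sum_Ico_consecutive _ hik hkj.le, Finset.sum_eq_sum_Ico_succ_bot hkj]
    rw [abs_le] at *
    constructor <;> nlinarith

lemma exists_K {θ : ℝ} (hθ : 1 < θ) : ∃ K : ℝ, 0 ≤ K ∧ 2 + 2 * K * (1 / 2 : ℝ) ^ θ ≤ K := by
  have h : (1 / 2 : ℝ) ^ θ < 1 / 2 := by
    have := Real.rpow_lt_rpow_of_exponent_gt (x := (1 / 2 : ℝ)) (by norm_num) (by norm_num) hθ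
    rwa [Real.rpow_one] at this
  have h' : 0 < 1 - 2 * (1 / 2 : ℝ) ^ θ := by linarith
  refine ⟨2 / (1 - 2 * (1 / 2 : ℝ) ^ θ), by positivity, ?_⟩
  have : 2 / (1 - 2 * (1 / 2 : ℝ) ^ θ) * (1 - 2 * (1 / 2 : ℝ) ^ θ) = 2 := div_mul_cancel₀ _ h'.ne'
  linarith

lemma sewing_range {G : ℝ → ℝ → ℝ} {C θ K : ℝ} (hθ : 1 < θ) (hC : 0 ≤ C) (hK : 0 ≤ K)
    (hK2 : 2 + 2 * K * (1 / 2 : ℝ) ^ θ ≤ K)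
    (hG : ∀ s u s', s ≤ u → u ≤ s' → |G s s' - G s u - G u s'| ≤ C * (s' - s) ^ θ)
    {σ : ℕ → ℝ} (hσ : Monotone σ) (m : ℕ) :
      |∑ k ∈ Finset.range m, G (σ k) (σ (k + 1)) - G (σ 0) (σ m)| ≤ K * C * (σ m - σ 0) ^ θ := by
  rw [Finset.range_eq_Ico]
  exact sewing_one hθ hC hK hK2 hG hσ m 0 m (Nat.zero_le _) (by omega)

lemma clamp_swap {G : ℝ → ℝ → ℝ} (h0 : ∀ a, G a a = 0) {a b c d : ℝ} (hab : a ≤ b) (hcd : c ≤ d) :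
    G (max a (min b c)) (max a (min b d)) = G (max c (min d a)) (max c (min d b)) := by
  rcases le_total b c with h | h
  · rw [min_eq_left h, min_eq_left (h.trans hcd), min_eq_right (by linarith : a ≤ d),
      min_eq_right (by linarith : b ≤ d), max_eq_left (by linarith : a ≤ c), max_eq_left h, h0, h0]
  rcases le_total d a with h' | h'
  · rw [min_eq_right h, min_eq_right (by linarith : d ≤ b), min_eq_left h',
      min_eq_left (by linarith : d ≤ b), max_eq_left (by linarith : c ≤ a), max_eq_left h', h0, h0]
  · rw [min_eq_right h, min_eq_right h', max_comm a c, min_comm b d,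
      max_eq_right (le_min h' hab), max_eq_right (le_min hcd h)]

lemma compare_half {G : ℝ → ℝ → ℝ} {C θ K : ℝ} (hθ : 1 < θ) (hC : 0 ≤ C) (hK : 0 ≤ K)
    (hK2 : 2 + 2 * K * (1 / 2 : ℝ) ^ θ ≤ K)
    (hG : ∀ s u s', s ≤ u → u ≤ s' → |G s s' - G s u - G u s'| ≤ C * (s' - s) ^ θ)
    {σ ρ : ℕ → ℝ} (hσ : Monotone σ) (hρ : Monotone ρ) {m m' : ℕ} (h0 : σ 0 = ρ 0)
    (h1 : σ m = ρ m') :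
    |∑ i ∈ Finset.range m, ∑ k ∈ Finset.range m',
        G (max (σ i) (min (σ (i + 1)) (ρ k))) (max (σ i) (min (σ (i + 1)) (ρ (k + 1))))
      - ∑ i ∈ Finset.range m, G (σ i) (σ (i + 1))|
      ≤ K * C * ∑ i ∈ Finset.range m, (σ (i + 1) - σ i) ^ θ := by
  rw [← Finset.sum_sub_distrib, Finset.mul_sum]
  refine (Finset.abs_sum_le_sum_abs _ _).trans (Finset.sum_le_sum fun i hi => ?_)
  have hi : i < m := Finset.mem_range.mp hi
  have hmono : Monotone (fun k => max (σ i) (min (σ (i + 1)) (ρ k))) := by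
    intro a b hab
    exact max_le_max le_rfl (min_le_min le_rfl (hρ hab))
  have := sewing_range hθ hC hK hK2 hG hmono m'
  have a1 : σ 0 ≤ σ i := hσ (Nat.zero_le _)
  have a2 : σ i ≤ σ (i + 1) := hσ (by omega)
  have a3 : σ (i + 1) ≤ σ m := hσ (by omega)
  have b1 : max (σ i) (min (σ (i + 1)) (ρ 0)) = σ i := by
    rw [max_eq_left]; exact (min_le_right _ _).trans (by linarith)
  have b2 : max (σ i) (min (σ (i + 1)) (ρ m')) = σ (i + 1) := by
    rw [min_eq_left (by linarith), max_eq_right a2]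
  simpa only [b1, b2] using this

lemma compare {G : ℝ → ℝ → ℝ} {C θ K : ℝ} (hθ : 1 < θ) (hC : 0 ≤ C) (hK : 0 ≤ K)
    (hK2 : 2 + 2 * K * (1 / 2 : ℝ) ^ θ ≤ K)
    (hG : ∀ s u s', s ≤ u → u ≤ s' → |G s s' - G s u - G u s'| ≤ C * (s' - s) ^ θ)
    {σ ρ : ℕ → ℝ} (hσ : Monotone σ) (hρ : Monotone ρ) {m m' : ℕ} (h0 : σ 0 = ρ 0)
    (h1 : σ m = ρ m') :
    |∑ i ∈ Finset.range m, G (σ i) (σ (i + 1)) - ∑ k ∈ Finset.range m', G (ρ k) (ρ (k + 1))|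
      ≤ K * C * (∑ i ∈ Finset.range m, (σ (i + 1) - σ i) ^ θ
        + ∑ k ∈ Finset.range m', (ρ (k + 1) - ρ k) ^ θ) := by
  have hz : ∀ a, G a a = 0 := by
    intro a
    have := hG a a a le_rfl le_rfl
    rw [sub_self a, Real.zero_rpow (by linarith), mul_zero, sub_self, zero_sub, abs_neg] at this
    exact abs_nonpos_iff.mp this
  have A := compare_half hθ hC hK hK2 hG hσ hρ h0 h1
  have B := compare_half hθ hC hK hK2 hG hρ hσ h0.symm h1.symm
  have E : ∑ i ∈ Finset.range m, ∑ k ∈ Finset.range m',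
        G (max (σ i) (min (σ (i + 1)) (ρ k))) (max (σ i) (min (σ (i + 1)) (ρ (k + 1))))
      = ∑ k ∈ Finset.range m', ∑ i ∈ Finset.range m,
        G (max (ρ k) (min (ρ (k + 1)) (σ i))) (max (ρ k) (min (ρ (k + 1)) (σ (i + 1)))) := by
    rw [Finset.sum_comm]
    refine Finset.sum_congr rfl fun k _ => Finset.sum_congr rfl fun i _ => ?_
    exact clamp_swap hz (hσ (by omega)) (hρ (by omega))
  rw [E] at A
  rw [mul_add]
  rw [abs_le] at *
  constructor <;> linarith [A.1, A.2, B.1, B.2]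

lemma mesh_sum {θ ε : ℝ} (hθ : 1 < θ) {σ : ℕ → ℝ} (hσ : Monotone σ) {m : ℕ}
    (hε : ∀ i < m, σ (i + 1) - σ i ≤ ε) (hε0 : 0 ≤ ε) (hl : σ m - σ 0 ≤ 1) :
    ∑ i ∈ Finset.range m, (σ (i + 1) - σ i) ^ θ ≤ ε ^ (θ - 1) := by
  have : ∑ i ∈ Finset.range m, (σ (i + 1) - σ i) ^ θ
      ≤ ∑ i ∈ Finset.range m, ε ^ (θ - 1) * (σ (i + 1) - σ i) := by
    refine Finset.sum_le_sum fun i hi => ?_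
    have h0 : 0 ≤ σ (i + 1) - σ i := sub_nonneg.mpr (hσ (by omega))
    have : (σ (i + 1) - σ i) ^ θ = (σ (i + 1) - σ i) ^ (θ - 1) * (σ (i + 1) - σ i) := by
      rw [← Real.rpow_add_one' h0 (by linarith)]; congr 1; ring
    rw [this]
    exact mul_le_mul_of_nonneg_right
      (Real.rpow_le_rpow h0 (hε i (Finset.mem_range.mp hi)) (by linarith)) h0
  refine this.trans ?_
  rw [← Finset.mul_sum, Finset.sum_range_sub]
  exact mul_le_of_le_one_right (Real.rpow_nonneg hε0 _) hl

lemma inner_bound {B : ℝ → ℝ → ℝ} {c θ K : ℝ} (hθ : 1 < θ) (hc : 0 ≤ c) (hK : 0 ≤ K)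
    (hK2 : 2 + 2 * K * (1 / 2 : ℝ) ^ θ ≤ K)
    (hB : ∀ t v t', t ≤ v → v ≤ t' → |B t t' - B t v - B v t'| ≤ c * (t' - t) ^ θ)
    (hB0 : ∀ t t', t ≤ t' → |B t t'| ≤ c)
    {τ : ℕ → ℝ} (hτ : Monotone τ) {m : ℕ} (hl : τ m - τ 0 ≤ 1) :
    |∑ j ∈ Finset.range m, B (τ j) (τ (j + 1))| ≤ (1 + K) * c := by
  have h := sewing_range hθ hc hK hK2 hB hτ m
  have h2 := hB0 (τ 0) (τ m) (hτ (Nat.zero_le _))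
  have h0 : 0 ≤ τ m - τ 0 := sub_nonneg.mpr (hτ (Nat.zero_le _))
  have h3 : (τ m - τ 0) ^ θ ≤ 1 := Real.rpow_le_one h0 hl (by linarith)
  have h4 := mul_le_mul_of_nonneg_left h3 (mul_nonneg hK hc)
  rw [abs_le] at *
  constructor <;> linarith [h.1, h.2, h2.1, h2.2]

/-- One-sided sewing condition. -/
def SewCond (θ C : ℝ) (A : ℝ → ℝ → ℝ → ℝ → ℝ) : Prop :=
  ∀ s u s', s ≤ u → u ≤ s' →
    (∀ t t', t ≤ t' → |A s s' t t' - A s u t t' - A u s' t t'| ≤ C * (s' - s) ^ θ) ∧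
    (∀ t v t', t ≤ v → v ≤ t' →
      |(A s s' t t' - A s u t t' - A u s' t t') - (A s s' t v - A s u t v - A u s' t v)
        - (A s s' v t' - A s u v t' - A u s' v t')| ≤ C * (s' - s) ^ θ * (t' - t) ^ θ)

def ZeroCond (θ C : ℝ) (D : ℝ → ℝ → ℝ → ℝ → ℝ) : Prop :=
  ∀ s s', s ≤ s' →
    (∀ t t', t ≤ t' → |D s s' t t'| ≤ C * (s' - s) ^ θ) ∧
    (∀ t v t', t ≤ v → v ≤ t' →
      |D s s' t t' - D s s' t v - D s s' v t'| ≤ C * (s' - s) ^ θ * (t' - t) ^ θ)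

def dsum (A : ℝ → ℝ → ℝ → ℝ → ℝ) (m m' : ℕ) (σ τ : ℕ → ℝ) : ℝ :=
  ∑ i ∈ Finset.range m, ∑ j ∈ Finset.range m', A (σ i) (σ (i + 1)) (τ j) (τ (j + 1))

/-- Monotone partition of mesh at most `ε`. -/
def MPart (a b ε : ℝ) (m : ℕ) (σ : ℕ → ℝ) : Prop :=
  Monotone σ ∧ σ 0 = a ∧ σ m = b ∧ ∀ i < m, σ (i + 1) - σ i ≤ ε

lemma dsum_compare_one {A : ℝ → ℝ → ℝ → ℝ → ℝ} {C θ K : ℝ} (hθ : 1 < θ) (hC : 0 ≤ C)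
    (hK : 0 ≤ K) (hK2 : 2 + 2 * K * (1 / 2 : ℝ) ^ θ ≤ K) (hA : SewCond θ C A)
    {a b c d ε ε' : ℝ} (hab : b - a ≤ 1) (hcd : d - c ≤ 1) (hε : 0 ≤ ε) {m m1 m' : ℕ}
    {σ σ1 τ : ℕ → ℝ}
    (hσ : MPart a b ε m σ) (hσ1 : MPart a b ε m1 σ1) (hτ : MPart c d ε' m' τ) :
    |dsum A m m' σ τ - dsum A m1 m' σ1 τ| ≤ 2 * (K * ((1 + K) * C)) * ε ^ (θ - 1) := by
  obtain ⟨hσm, hσ0, hσe, hσε⟩ := hσ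
  obtain ⟨hσm1, hσ01, hσe1, hσε1⟩ := hσ1
  obtain ⟨hτm, hτ0, hτe, hτε⟩ := hτ
  have hG : ∀ s u s', s ≤ u → u ≤ s' →
      |(∑ j ∈ Finset.range m', A s s' (τ j) (τ (j + 1)))
        - (∑ j ∈ Finset.range m', A s u (τ j) (τ (j + 1)))
        - (∑ j ∈ Finset.range m', A u s' (τ j) (τ (j + 1)))| ≤ ((1 + K) * C) * (s' - s) ^ θ := by
    intro s u s' h1 h2
    obtain ⟨p, q⟩ := hA s u s' h1 h2
    rw [← Finset.sum_sub_distrib, ← Finset.sum_sub_distrib, mul_assoc]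
    exact inner_bound (B := fun t t' => A s s' t t' - A s u t t' - A u s' t t') hθ
      (mul_nonneg hC (Real.rpow_nonneg (by linarith) _)) hK hK2 q p hτm (by linarith)
  have := compare (G := fun s s' => ∑ j ∈ Finset.range m', A s s' (τ j) (τ (j + 1)))
    hθ (by positivity) hK hK2 hG hσm hσm1 (m := m) (m' := m1) (by linarith) (by linarith)
  refine this.trans ?_
  have e1 := mesh_sum hθ hσm hσε hε (by linarith)
  have e2 := mesh_sum hθ hσm1 hσε1 hε (by linarith)
  have e3 := mul_le_mul_of_nonneg_left (add_le_add e1 e2)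
    (by positivity : 0 ≤ K * ((1 + K) * C))
  linarith

lemma dsum_flip (A : ℝ → ℝ → ℝ → ℝ → ℝ) (m m' : ℕ) (σ τ : ℕ → ℝ) :
    dsum (fun t t' s s' => A s s' t t') m' m τ σ = dsum A m m' σ τ := by
  unfold dsum; rw [Finset.sum_comm]

lemma dsum_compare {A : ℝ → ℝ → ℝ → ℝ → ℝ} {C θ : ℝ} (hθ : 1 < θ) (hC : 0 ≤ C)
    (hA : SewCond θ C A) (hA' : SewCond θ C (fun t t' s s' => A s s' t t')) :
    ∃ M : ℝ, 0 ≤ M ∧ ∀ {a b c d ε : ℝ} (_ : b - a ≤ 1) (_ : d - c ≤ 1) (_ : 0 ≤ ε) {m m1 m' m1' : ℕ}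
    {σ σ1 τ τ1 : ℕ → ℝ}
    (_ : MPart a b ε m σ) (_ : MPart a b ε m1 σ1) (_ : MPart c d ε m' τ)
    (_ : MPart c d ε m1' τ1),
    |dsum A m m' σ τ - dsum A m1 m1' σ1 τ1| ≤ M * ε ^ (θ - 1) := by
  obtain ⟨K, hK, hK2⟩ := exists_K hθ
  refine ⟨4 * (K * ((1 + K) * C)), by positivity, ?_⟩
  intro a b c d ε hab hcd hε m m1 m' m1' σ σ1 τ τ1 hσ hσ1 hτ hτ1
  have h1 := dsum_compare_one hθ hC hK hK2 hA hab hcd hε hσ hσ1 hτ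
  have h2 := dsum_compare_one hθ hC hK hK2 hA' hcd hab hε hτ hτ1 hσ1
  rw [dsum_flip A m1 m' σ1 τ, dsum_flip A m1 m1' σ1 τ1] at h2
  rw [abs_le] at *
  constructor <;> linarith [h1.1, h1.2, h2.1, h2.2]

lemma dsum_zero {D : ℝ → ℝ → ℝ → ℝ → ℝ} {C θ : ℝ} (hθ : 1 < θ) (hC : 0 ≤ C)
    (hD : ZeroCond θ C D) :
    ∃ M : ℝ, 0 ≤ M ∧ ∀ {a b c d ε : ℝ} (_ : b - a ≤ 1) (_ : d - c ≤ 1) (_ : 0 ≤ ε) {m m' : ℕ}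
    {σ τ : ℕ → ℝ} (_ : MPart a b ε m σ) (_ : MPart c d ε m' τ),
    |dsum D m m' σ τ| ≤ M * ε ^ (θ - 1) := by
  obtain ⟨K, hK, hK2⟩ := exists_K hθ
  refine ⟨(1 + K) * C, by positivity, ?_⟩
  intro a b c d ε hab hcd hε m m' σ τ hσ hτ
  obtain ⟨hσm, hσ0, hσe, hσε⟩ := hσ
  obtain ⟨hτm, hτ0, hτe, hτε⟩ := hτ
  have e1 := mesh_sum hθ hσm hσε hε (by linarith)
  refine le_trans ?_ (mul_le_mul_of_nonneg_left e1 (by positivity))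
  unfold dsum
  rw [Finset.mul_sum]
  refine (Finset.abs_sum_le_sum_abs _ _).trans (Finset.sum_le_sum fun i hi => ?_)
  have h : σ i ≤ σ (i + 1) := hσm (by omega)
  obtain ⟨p, q⟩ := hD _ _ h
  rw [mul_assoc]
  exact inner_bound (B := fun t t' => D (σ i) (σ (i + 1)) t t') hθ
      (mul_nonneg hC (Real.rpow_nonneg (by linarith) _)) hK hK2 q p hτm (by linarith)

/-- Global Hölder bounds. -/
structure Hol (γ M : ℝ) (X : ℝ → ℝ → ℝ) : Prop where
  b : ∀ s t, |X s t| ≤ M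
  h1 : ∀ s s' t, |X s' t - X s t| ≤ M * |s' - s| ^ γ
  h2 : ∀ s t t', |X s t' - X s t| ≤ M * |t' - t| ^ γ
  hr : ∀ s s' t t', |X s' t' - X s t' - X s' t + X s t| ≤ M * (|s' - s| ^ γ * |t' - t| ^ γ)

lemma Hol.flip {γ M : ℝ} {X : ℝ → ℝ → ℝ} (h : Hol γ M X) : Hol γ M (fun t s => X s t) where
  b := fun s t => h.b t s
  h1 := fun s s' t => h.h2 t s s'
  h2 := fun s t t' => h.h1 t t' s
  hr := fun s s' t t' => by
    have := h.hr t t' s s'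
    rw [mul_comm (|s' - s| ^ γ)]
    convert this using 2
    ring

lemma rpow_sub_mono {γ s a b s' : ℝ} (hγ : 0 ≤ γ) (h1 : s ≤ a) (h2 : a ≤ b) (h3 : b ≤ s') :
    |b - a| ^ γ ≤ (s' - s) ^ γ := by
  rw [abs_of_nonneg (by linarith)]
  exact Real.rpow_le_rpow (by linarith) (by linarith) hγ

lemma Hol.n {γ M : ℝ} {X : ℝ → ℝ → ℝ} (h : Hol γ M X) : 0 ≤ M :=
  (abs_nonneg _).trans (h.b 0 0)

lemma Hol.m1 {γ M : ℝ} {X : ℝ → ℝ → ℝ} (h : Hol γ M X) (hγ : 0 ≤ γ) {s a b s' : ℝ}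
    (h1 : s ≤ a) (h2 : a ≤ b) (h3 : b ≤ s') (t : ℝ) : |X b t - X a t| ≤ M * (s' - s) ^ γ :=
  (h.h1 _ _ _).trans (mul_le_mul_of_nonneg_left (rpow_sub_mono hγ h1 h2 h3) h.n)

lemma Hol.m2 {γ M : ℝ} {X : ℝ → ℝ → ℝ} (h : Hol γ M X) (hγ : 0 ≤ γ) {s a b s' : ℝ}
    (h1 : s ≤ a) (h2 : a ≤ b) (h3 : b ≤ s') (t : ℝ) : |X t b - X t a| ≤ M * (s' - s) ^ γ :=
  (h.h2 _ _ _).trans (mul_le_mul_of_nonneg_left (rpow_sub_mono hγ h1 h2 h3) h.n)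

lemma Hol.mr {γ M : ℝ} {X : ℝ → ℝ → ℝ} (h : Hol γ M X) (hγ : 0 ≤ γ) {s a b s' t c d t' : ℝ}
    (h1 : s ≤ a) (h2 : a ≤ b) (h3 : b ≤ s') (k1 : t ≤ c) (k2 : c ≤ d) (k3 : d ≤ t') :
    |X b d - X a d - X b c + X a c| ≤ M * ((s' - s) ^ γ * (t' - t) ^ γ) := by
  refine (h.hr _ _ _ _).trans (mul_le_mul_of_nonneg_left ?_ h.n)
  exact mul_le_mul (rpow_sub_mono hγ h1 h2 h3) (rpow_sub_mono hγ k1 k2 k3)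
    (Real.rpow_nonneg (abs_nonneg _) _) (Real.rpow_nonneg (by linarith) _)

lemma Hol.mr0 {γ M : ℝ} {X : ℝ → ℝ → ℝ} (h : Hol γ M X) (hγ : 0 ≤ γ) {s a b s' : ℝ}
    (h1 : s ≤ a) (h2 : a ≤ b) (h3 : b ≤ s') (c d : ℝ) :
    |X b d - X a d - X b c + X a c| ≤ 2 * (M * (s' - s) ^ γ) := by
  have p := h.m1 hγ h1 h2 h3 c
  have q := h.m1 hγ h1 h2 h3 d
  rw [abs_le] at *
  constructor <;> linarith [p.1, p.2, q.1, q.2]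

lemma amul {a b A B : ℝ} (ha : |a| ≤ A) (hb : |b| ≤ B) : |a * b| ≤ A * B := by
  rw [abs_mul]
  exact mul_le_mul ha hb (abs_nonneg _) ((abs_nonneg _).trans ha)

lemma aadd {a b A B : ℝ} (ha : |a| ≤ A) (hb : |b| ≤ B) : |a + b| ≤ A + B :=
  (abs_add_le a b).trans (add_le_add ha hb)

lemma rpow_two_mul' {x γ : ℝ} (hx : 0 ≤ x) (hγ : 0 < γ) : x ^ (2 * γ) = x ^ γ * x ^ γ := by
  rw [two_mul, Real.rpow_add' hx (by linarith)]

def germ3 (X Y : ℝ → ℝ → ℝ) (s s' t t' : ℝ) : ℝ :=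
  Y s t * (X s' t - X s t) * (X s t' - X s t)

def germ4 (X Y : ℝ → ℝ → ℝ) (s s' t t' : ℝ) : ℝ :=
  Y s t * (X s' t' - X s t' - X s' t + X s t)

def germD (X Y : ℝ → ℝ → ℝ) (s s' t t' : ℝ) : ℝ :=
  Y s t * (X s' t - X s t) * (X s' t' - X s t' - X s' t + X s t)

lemma germ3_sew {γ M : ℝ} (hγ : 0 < γ) {X Y : ℝ → ℝ → ℝ} (hX : Hol γ M X) (hY : Hol γ M Y) :
    SewCond (2 * γ) (4 * M ^ 3) (germ3 X Y) := by
  intro s u s' h1 h2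
  have hs : 0 ≤ s' - s := by linarith
  rw [rpow_two_mul' hs hγ]
  constructor
  · intro t t' ht
    set w := (s' - s) ^ γ with hw
    have e : germ3 X Y s s' t t' - germ3 X Y s u t t' - germ3 X Y u s' t t' =
        (-1) * ((X s' t - X u t) * ((Y u t - Y s t) * (X s t' - X s t)
          + Y u t * (X u t' - X s t' - X u t + X s t))) := by
      unfold germ3; ring
    have b1 := hX.m1 hγ.le h1 h2 le_rfl t
    have b2 := hY.m1 hγ.le le_rfl h1 h2 t
    have b3 := hX.b s t
    have b3' := hX.b s t'
    have b4 := hY.b u t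
    have b5 := hX.mr0 hγ.le le_rfl h1 h2 t t'
    have b6 : |X s t' - X s t| ≤ 2 * M := by
      rw [abs_le] at *
      constructor <;> linarith [b3.1, b3.2, b3'.1, b3'.2]
    rw [e, abs_mul, abs_neg, abs_one, one_mul]
    refine (amul b1 (aadd (amul b2 b6) (amul b4 b5))).trans (le_of_eq ?_)
    ring
  · intro t v t' k1 k2
    have ht : 0 ≤ t' - t := by linarith
    rw [rpow_two_mul' ht hγ]
    have e : (germ3 X Y s s' t t' - germ3 X Y s u t t' - germ3 X Y u s' t t')
        - (germ3 X Y s s' t v - germ3 X Y s u t v - germ3 X Y u s' t v)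
        - (germ3 X Y s s' v t' - germ3 X Y s u v t' - germ3 X Y u s' v t') =
        ((X s' v - X u v - X s' t + X u t) * (Y u v - Y s v)
          + (X s' t - X u t) * (Y u v - Y s v - Y u t + Y s t)) * (X s t' - X s v)
        + ((X s' v - X u v - X s' t + X u t) * Y u v + (X s' t - X u t) * (Y u v - Y u t))
          * (X u t' - X s t' - X u v + X s v) := by
      unfold germ3; ring
    have b1 := hX.mr hγ.le h1 h2 le_rfl le_rfl k1 k2
    have b2 := hY.m1 hγ.le le_rfl h1 h2 v
    have b3 := hX.m1 hγ.le h1 h2 le_rfl t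
    have b4 := hY.mr hγ.le le_rfl h1 h2 le_rfl k1 k2
    have b5 := hX.m2 hγ.le k1 k2 le_rfl s
    have b6 := hY.b u v
    have b7 := hY.m2 hγ.le le_rfl k1 k2 u
    have b8 := hX.mr hγ.le le_rfl h1 h2 k1 k2 le_rfl
    rw [e]
    refine (aadd (amul (aadd (amul b1 b2) (amul b3 b4)) b5)
      (amul (aadd (amul b1 b6) (amul b3 b7)) b8)).trans (le_of_eq ?_)
    ring

lemma germ4_sew {γ M : ℝ} (hγ : 0 < γ) {X Y : ℝ → ℝ → ℝ} (hX : Hol γ M X) (hY : Hol γ M Y) :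
    SewCond (2 * γ) (2 * M ^ 2) (germ4 X Y) := by
  intro s u s' h1 h2
  have hs : 0 ≤ s' - s := by linarith
  rw [rpow_two_mul' hs hγ]
  constructor
  · intro t t' ht
    have e : germ4 X Y s s' t t' - germ4 X Y s u t t' - germ4 X Y u s' t t' =
        (-1) * ((Y u t - Y s t) * (X s' t' - X u t' - X s' t + X u t)) := by
      unfold germ4; ring
    have b2 := hY.m1 hγ.le le_rfl h1 h2 t
    have b5 := hX.mr0 hγ.le h1 h2 le_rfl t t'
    rw [e, abs_mul, abs_neg, abs_one, one_mul]
    refine (amul b2 b5).trans (le_of_eq ?_)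
    ring
  · intro t v t' k1 k2
    have ht : 0 ≤ t' - t := by linarith
    rw [rpow_two_mul' ht hγ]
    have e : (germ4 X Y s s' t t' - germ4 X Y s u t t' - germ4 X Y u s' t t')
        - (germ4 X Y s s' t v - germ4 X Y s u t v - germ4 X Y u s' t v)
        - (germ4 X Y s s' v t' - germ4 X Y s u v t' - germ4 X Y u s' v t') =
        (Y u v - Y s v - Y u t + Y s t) * (X s' t' - X u t' - X s' v + X u v) := by
      unfold germ4; ring
    have b4 := hY.mr hγ.le le_rfl h1 h2 le_rfl k1 k2
    have b8 := hX.mr hγ.le h1 h2 le_rfl k1 k2 le_rfl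
    rw [e]
    refine (amul b4 b8).trans ?_
    have : 0 ≤ M ^ 2 * ((s' - s) ^ γ * (t' - t) ^ γ) ^ 2 := by positivity
    linarith

lemma germD_zero {γ M : ℝ} (hγ : 0 < γ) {X Y : ℝ → ℝ → ℝ} (hX : Hol γ M X) (hY : Hol γ M Y) :
    ZeroCond (2 * γ) (2 * M ^ 3) (germD X Y) := by
  intro s s' h1
  have hs : 0 ≤ s' - s := by linarith
  rw [rpow_two_mul' hs hγ]
  constructor
  · intro t t' ht
    have b1 := hY.b s t
    have b2 := hX.m1 hγ.le le_rfl h1 le_rfl t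
    have b5 := hX.mr0 hγ.le le_rfl h1 le_rfl t t'
    unfold germD
    refine (amul (amul b1 b2) b5).trans (le_of_eq ?_)
    ring
  · intro t v t' k1 k2
    have ht : 0 ≤ t' - t := by linarith
    rw [rpow_two_mul' ht hγ]
    have e : germD X Y s s' t t' - germD X Y s s' t v - germD X Y s s' v t' =
        (-1) * (((Y s v - Y s t) * (X s' v - X s v)
          + Y s t * (X s' v - X s v - X s' t + X s t)) * (X s' t' - X s t' - X s' v + X s v)) := by
      unfold germD; ring
    have b1 := hY.m2 hγ.le le_rfl k1 k2 s
    have b2 := hX.m1 hγ.le le_rfl h1 le_rfl v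
    have b3 := hY.b s t
    have b4 := hX.mr hγ.le le_rfl h1 le_rfl le_rfl k1 k2
    have b8 := hX.mr hγ.le le_rfl h1 le_rfl k1 k2 le_rfl
    rw [e, abs_mul, abs_neg, abs_one, one_mul]
    refine (amul (aadd (amul b1 b2) (amul b3 b4)) b8).trans (le_of_eq ?_)
    ring

lemma Hol.mono {γ M M' : ℝ} {X : ℝ → ℝ → ℝ} (h : Hol γ M X) (hM : M ≤ M') : Hol γ M' X where
  b := fun s t => (h.b s t).trans hM
  h1 := fun s s' t => (h.h1 s s' t).trans
    (mul_le_mul_of_nonneg_right hM (Real.rpow_nonneg (abs_nonneg _) _))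
  h2 := fun s t t' => (h.h2 s t t').trans
    (mul_le_mul_of_nonneg_right hM (Real.rpow_nonneg (abs_nonneg _) _))
  hr := fun s s' t t' => (h.hr s s' t t').trans
    (mul_le_mul_of_nonneg_right hM (by positivity))

lemma lip_of_C1 {ψ : ℝ → ℝ} (hψ : ContDiff ℝ 1 ψ) (R : ℝ) :
    ∃ L : ℝ, 0 ≤ L ∧ ∀ a ∈ Icc (-R) R, ∀ b ∈ Icc (-R) R, |ψ b - ψ a| ≤ L * |b - a| := by
  have hc : Continuous (deriv ψ) := hψ.continuous_deriv le_rfl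
  obtain ⟨L, hL⟩ := (isCompact_Icc (a := -R) (b := R)).exists_bound_of_continuousOn hc.continuousOn
  refine ⟨max L 0, le_max_right _ _, fun a ha b hb => ?_⟩
  exact Convex.norm_image_sub_le_of_norm_deriv_le
    (fun x _ => (hψ.differentiable one_ne_zero).differentiableAt)
    (fun x hx => (hL x hx).trans (le_max_left _ _)) (convex_Icc _ _) ha hb

lemma Hol.comp {γ M : ℝ} {X : ℝ → ℝ → ℝ} (h : Hol γ M X) {φ : ℝ → ℝ} (hφ : ContDiff ℝ 2 φ) :
    ∃ M', Hol γ M' (fun s t => φ (X s t)) := by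
  have hM := h.n
  obtain ⟨L, hL0, hL⟩ := lip_of_C1 (hφ.of_le (by norm_num)) (3 * M)
  have hd : ContDiff ℝ 1 (deriv φ) := by
    have h2 : ContDiff ℝ (1 + 1) φ := by convert hφ using 1; norm_num
    exact (contDiff_succ_iff_deriv.mp h2).2.2
  have hdiff : Differentiable ℝ φ := hφ.differentiable (by norm_num)
  obtain ⟨L2, hL20, hL2⟩ := lip_of_C1 hd (3 * M)
  obtain ⟨B, hB⟩ := (isCompact_Icc (a := -(3 * M)) (b := 3 * M)).exists_bound_of_continuousOn
    hφ.continuous.continuousOn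
  have hmem : ∀ s t, X s t ∈ Icc (-(3 * M)) (3 * M) := by
    intro s t
    have := abs_le.mp (h.b s t)
    constructor <;> linarith [this.1, this.2]
  have second : ∀ a b c d, |a| ≤ M → |b| ≤ M → |c| ≤ M → |d| ≤ M →
      |φ d - φ c - φ b + φ a| ≤ L * |d - c - b + a| + L2 * |b - a| * |c - a| := by
    intro a b c d ha hb hc hd
    rw [abs_le] at ha hb hc hd
    have e1 := hL (b + c - a) ⟨by linarith, by linarith⟩ d ⟨by linarith, by linarith⟩
    have e2 : |(φ (c + (b - a)) - φ c) - (φ (a + (b - a)) - φ a)| ≤ L2 * |b - a| * |c - a| := by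
      have hder : ∀ x, HasDerivAt (fun z => φ (z + (b - a)) - φ z)
          (deriv φ (x + (b - a)) - deriv φ x) x := by
        intro x
        have p := (hdiff (x + (b - a))).hasDerivAt.comp_add_const x (b - a)
        exact p.sub (hdiff x).hasDerivAt
      refine Convex.norm_image_sub_le_of_norm_hasDerivWithin_le (s := uIcc a c)
        (f := fun z => φ (z + (b - a)) - φ z)
        (fun x _ => (hder x).hasDerivWithinAt) ?_ (convex_uIcc _ _) left_mem_uIcc right_mem_uIcc
      intro x hx
      have hx1 : -M ≤ x := (le_min ha.1 hc.1).trans hx.1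
      have hx2 : x ≤ M := hx.2.trans (max_le ha.2 hc.2)
      have := hL2 x ⟨by linarith, by linarith⟩ (x + (b - a)) ⟨by linarith, by linarith⟩
      rwa [add_sub_cancel_left] at this
    have e3 : φ d - φ c - φ b + φ a = (φ d - φ (b + c - a)) +
        ((φ (c + (b - a)) - φ c) - (φ (a + (b - a)) - φ a)) := by
      rw [show c + (b - a) = b + c - a by ring, show a + (b - a) = b by ring]; ring
    rw [e3]
    refine aadd (e1.trans (le_of_eq ?_)) e2
    congr 2; ring
  have H : 0 ≤ max B 0 := le_max_right _ _
  refine ⟨max B 0 + L * M + L2 * M * M, ?_, ?_, ?_, ?_⟩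
  · intro s t
    have := hB _ (hmem s t)
    rw [Real.norm_eq_abs] at this
    have h3 : 0 ≤ L * M := by positivity
    have h4 : 0 ≤ L2 * M * M := by positivity
    linarith [le_max_left B 0]
  · intro s s' t
    have := (hL _ (hmem s t) _ (hmem s' t)).trans (mul_le_mul_of_nonneg_left (h.h1 s s' t) hL0)
    refine this.trans ?_
    rw [← mul_assoc]
    apply mul_le_mul_of_nonneg_right _ (by positivity)
    have h4 : 0 ≤ L2 * M * M := by positivity
    linarith
  · intro s t t'
    have := (hL _ (hmem s t) _ (hmem s t')).trans (mul_le_mul_of_nonneg_left (h.h2 s t t') hL0)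
    refine this.trans ?_
    rw [← mul_assoc]
    apply mul_le_mul_of_nonneg_right _ (by positivity)
    have h4 : 0 ≤ L2 * M * M := by positivity
    linarith
  · intro s s' t t'
    have := second (X s t) (X s' t) (X s t') (X s' t') (h.b _ _) (h.b _ _) (h.b _ _) (h.b _ _)
    refine this.trans ?_
    have p1 := mul_le_mul_of_nonneg_left (h.hr s s' t t') hL0
    have p2 := mul_le_mul_of_nonneg_left (mul_le_mul (h.h1 s s' t) (h.h2 s t t') (abs_nonneg _)
      (by positivity)) hL20
    have p3 : 0 ≤ max B 0 * (|s' - s| ^ γ * |t' - t| ^ γ) := by positivity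
    nlinarith

def clp (s : ℝ) : ℝ := max 0 (min 1 s)

lemma clp_mem (s : ℝ) : clp s ∈ I01 := by
  unfold clp I01
  exact ⟨le_max_left _ _, max_le zero_le_one (min_le_left _ _)⟩

lemma clp_eq {s : ℝ} (h : s ∈ I01) : clp s = s := by
  unfold clp
  rw [min_eq_right h.2, max_eq_right h.1]

lemma clp_lip (s s' : ℝ) : |clp s' - clp s| ≤ |s' - s| := by
  unfold clp
  refine (abs_max_sub_max_le_max _ _ _ _).trans ?_
  rw [sub_self, abs_zero, max_eq_right (abs_nonneg _)]
  refine (abs_min_sub_min_le_max _ _ _ _).trans ?_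
  rw [sub_self, abs_zero, max_eq_right (abs_nonneg _)]

lemma clp_rpow {γ γ' : ℝ} (h0 : 0 < γ) (h : γ ≤ γ') (s s' : ℝ) :
    |clp s' - clp s| ^ γ' ≤ |s' - s| ^ γ := by
  have h1 : |clp s' - clp s| ≤ 1 := by
    have a := clp_mem s
    have b := clp_mem s'
    unfold I01 at a b
    rw [abs_le]
    constructor <;> linarith [a.1, a.2, b.1, b.2]
  calc |clp s' - clp s| ^ γ' ≤ |clp s' - clp s| ^ γ :=
        Real.rpow_le_rpow_of_exponent_ge_of_imp (abs_nonneg _) h1 h (fun _ h' => absurd h' (h0.trans_le h).ne')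
    _ ≤ _ := Real.rpow_le_rpow (abs_nonneg _) (clp_lip _ _) h0.le

lemma le_of_ofReal_div {a b : ℝ} {N : ℝ≥0∞} (hN : N ≠ ⊤) (hb : 0 ≤ b) (ha : b = 0 → a = 0)
    (h : ENNReal.ofReal (a / b) ≤ N) : a ≤ N.toReal * b := by
  have := (ENNReal.ofReal_le_iff_le_toReal hN).mp h
  rcases hb.eq_or_lt with h0 | h0
  · rw [ha h0.symm, ← h0, mul_zero]
  · exact (div_le_iff₀ h0).mp this

lemma hol_of_NN {γ1 γ2 γ : ℝ} {x : ℝ → ℝ → ℝ} (hγ : 0 < γ) (h1 : γ ≤ γ1) (h2 : γ ≤ γ2)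
    (hN : NN γ1 γ2 x ≠ ⊤) : Hol γ (NN γ1 γ2 x).toReal (fun s t => x (clp s) (clp t)) := by
  have hM : 0 ≤ (NN γ1 γ2 x).toReal := ENNReal.toReal_nonneg
  have zero_of : ∀ {a b : ℝ} {c : ℝ}, |b - a| ^ c = 0 → b = a := by
    intro a b c h
    exact sub_eq_zero.mp (abs_eq_zero.mp ((Real.rpow_eq_zero_iff_of_nonneg (abs_nonneg _)).mp h).1)
  refine ⟨?_, ?_, ?_, ?_⟩
  · intro s t
    have : ENNReal.ofReal |x (clp s) (clp t)| ≤ NN γ1 γ2 x := by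
      refine le_trans ?_ (le_add_self : holInf x ≤ NN γ1 γ2 x)
      exact le_iSup₂_of_le (⟨clp s, clp_mem s⟩ : I01) (⟨clp t, clp_mem t⟩ : I01) le_rfl
    exact (ENNReal.ofReal_le_iff_le_toReal hN).mp this
  · intro s s' t
    have : ENNReal.ofReal (|d1 x (clp s) (clp s') (clp t)| / |clp s' - clp s| ^ γ1)
        ≤ NN γ1 γ2 x := by
      refine le_trans ?_ (show hol1 γ1 x ≤ NN γ1 γ2 x from ?_)
      · exact le_iSup₂_of_le (⟨clp s, clp_mem s⟩ : I01) (⟨clp s', clp_mem s'⟩ : I01)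
          (le_iSup_of_le (⟨clp t, clp_mem t⟩ : I01) le_rfl)
      · exact (le_add_self.trans le_self_add).trans le_self_add
    refine (le_of_ofReal_div hN (Real.rpow_nonneg (abs_nonneg _) _) ?_ this).trans
      (mul_le_mul_of_nonneg_left (clp_rpow hγ h1 s s') hM)
    intro h
    rw [zero_of h]; simp [d1]
  · intro s t t'
    have : ENNReal.ofReal (|d2 x (clp s) (clp t) (clp t')| / |clp t' - clp t| ^ γ2)
        ≤ NN γ1 γ2 x := by
      refine le_trans ?_ (show hol2 γ2 x ≤ NN γ1 γ2 x from ?_)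
      · exact le_iSup₂_of_le (⟨clp s, clp_mem s⟩ : I01) (⟨clp t, clp_mem t⟩ : I01)
          (le_iSup_of_le (⟨clp t', clp_mem t'⟩ : I01) le_rfl)
      · exact le_add_self.trans le_self_add
    refine (le_of_ofReal_div hN (Real.rpow_nonneg (abs_nonneg _) _) ?_ this).trans
      (mul_le_mul_of_nonneg_left (clp_rpow hγ h2 t t') hM)
    intro h
    rw [zero_of h]; simp [d2]
  · intro s s' t t'
    have : ENNReal.ofReal (|dRect x (clp s) (clp s') (clp t) (clp t')| /
        (|clp s' - clp s| ^ γ1 * |clp t' - clp t| ^ γ2)) ≤ NN γ1 γ2 x := by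
      refine le_trans ?_ (show holRect γ1 γ2 x ≤ NN γ1 γ2 x from ?_)
      · exact le_iSup₂_of_le (⟨clp s, clp_mem s⟩ : I01) (⟨clp s', clp_mem s'⟩ : I01)
          (le_iSup₂_of_le (⟨clp t, clp_mem t⟩ : I01) (⟨clp t', clp_mem t'⟩ : I01) le_rfl)
      · exact (le_self_add.trans le_self_add).trans le_self_add
    refine (le_of_ofReal_div hN (by positivity) ?_ this).trans
      (mul_le_mul_of_nonneg_left (mul_le_mul (clp_rpow hγ h1 s s') (clp_rpow hγ h2 t t')
        (by positivity) (by positivity)) hM)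
    intro h
    rcases mul_eq_zero.mp h with h | h
    · rw [zero_of h]; simp [dRect]
    · rw [zero_of h]; simp [dRect]

/-- Partition sequences in monotone form. -/
def MSeq (a b : ℝ) (m : ℕ → ℕ) (σ : ℕ → ℕ → ℝ) : Prop :=
  ∀ ε : ℝ, 0 < ε → ∃ N, ∀ n ≥ N, MPart a b ε (m n) (σ n)

lemma IsPartSeq.mseq {a b : ℝ} {m : ℕ → ℕ} {σ : ℕ → ℕ → ℝ} (h : IsPartSeq a b m σ) :
    MSeq a b m (fun n k => σ n (min k (m n))) := by
  obtain ⟨h0, h1, h2, h3⟩ := h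
  intro ε hε
  obtain ⟨N, hN⟩ := h3 ε hε
  refine ⟨N, fun n hn => ⟨?_, ?_, ?_, ?_⟩⟩
  · apply monotone_nat_of_le_succ
    intro k
    show σ n (min k (m n)) ≤ σ n (min (k + 1) (m n))
    rcases lt_or_ge k (m n) with hk | hk
    · rw [min_eq_left hk.le, min_eq_left (by omega)]
      exact (h2 n k hk).le
    · rw [min_eq_right hk, min_eq_right (by omega)]
  · simp [h0]
  · simp [h1]
  · intro i hi
    show σ n (min (i + 1) (m n)) - σ n (min i (m n)) ≤ ε
    rw [min_eq_left hi.le, min_eq_left (by omega)]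
    exact (hN n hn i hi).le

lemma small_rpow {M p η : ℝ} (hp : 0 < p) (hη : 0 < η) :
    ∃ ε : ℝ, 0 < ε ∧ M * ε ^ p < η := by
  have hc : ContinuousAt (fun ε : ℝ => M * ε ^ p) 0 :=
    (Real.continuousAt_rpow_const 0 p (Or.inr hp.le)).const_mul M
  have ht : Tendsto (fun ε : ℝ => M * ε ^ p) (𝓝[>] 0) (𝓝 0) := by
    have : Tendsto (fun ε : ℝ => M * ε ^ p) (𝓝 0) (𝓝 (M * 0 ^ p)) := hc
    rw [Real.zero_rpow hp.ne', mul_zero] at this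
    exact this.mono_left nhdsWithin_le_nhds
  have h1 := ht.eventually (gt_mem_nhds hη)
  obtain ⟨ε, h, h'⟩ := (h1.and self_mem_nhdsWithin).exists
  exact ⟨ε, h', h⟩

lemma exists_limit {A : ℝ → ℝ → ℝ → ℝ → ℝ} {C θ : ℝ} (hθ : 1 < θ) (hC : 0 ≤ C)
    (hA : SewCond θ C A) (hA' : SewCond θ C (fun t t' s s' => A s s' t t'))
    {a b c d : ℝ} (hab : b - a ≤ 1) (hcd : d - c ≤ 1) :
    ∃ L : ℝ, ∀ m m' σ τ, MSeq a b m σ → MSeq c d m' τ →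
      Tendsto (fun n => dsum A (m n) (m' n) (σ n) (τ n)) atTop (𝓝 L) := by
  obtain ⟨M, hM, hcmp⟩ := dsum_compare hθ hC hA hA'
  by_cases hex : ∃ m m' σ τ, MSeq a b m σ ∧ MSeq c d m' τ
  swap
  · exact ⟨0, fun m m' σ τ h1 h2 => absurd ⟨m, m', σ, τ, h1, h2⟩ hex⟩
  have key : ∀ η > 0, ∃ ε : ℝ, 0 < ε ∧ ∀ {m m1 m' m1' : ℕ} {σ σ1 τ τ1 : ℕ → ℝ},
      MPart a b ε m σ → MPart a b ε m1 σ1 → MPart c d ε m' τ → MPart c d ε m1' τ1 →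
      |dsum A m m' σ τ - dsum A m1 m1' σ1 τ1| < η := by
    intro η hη
    obtain ⟨ε, hε, h⟩ := small_rpow (M := M) (p := θ - 1) (by linarith) hη
    exact ⟨ε, hε, fun h1 h2 h3 h4 => (hcmp hab hcd hε.le h1 h2 h3 h4).trans_lt h⟩
  obtain ⟨m0, m0', σ0, τ0, hσ0, hτ0⟩ := hex
  have hcau : CauchySeq (fun n => dsum A (m0 n) (m0' n) (σ0 n) (τ0 n)) := by
    rw [Metric.cauchySeq_iff]
    intro η hη
    obtain ⟨ε, hε, h⟩ := key η hη
    obtain ⟨N1, hN1⟩ := hσ0 ε hε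
    obtain ⟨N2, hN2⟩ := hτ0 ε hε
    refine ⟨max N1 N2, fun p hp q hq => ?_⟩
    exact h (hN1 p (le_of_max_le_left hp)) (hN1 q (le_of_max_le_left hq))
      (hN2 p (le_of_max_le_right hp)) (hN2 q (le_of_max_le_right hq))
  obtain ⟨L, hL⟩ := cauchySeq_tendsto_of_complete hcau
  refine ⟨L, fun m m' σ τ hσ hτ => ?_⟩
  have hdiff : Tendsto (fun n => dsum A (m n) (m' n) (σ n) (τ n)
      - dsum A (m0 n) (m0' n) (σ0 n) (τ0 n)) atTop (𝓝 0) := by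
    rw [Metric.tendsto_atTop]
    intro η hη
    obtain ⟨ε, hε, h⟩ := key η hη
    obtain ⟨N1, hN1⟩ := hσ0 ε hε
    obtain ⟨N2, hN2⟩ := hτ0 ε hε
    obtain ⟨N3, hN3⟩ := hσ ε hε
    obtain ⟨N4, hN4⟩ := hτ ε hε
    refine ⟨max (max N1 N2) (max N3 N4), fun n hn => ?_⟩
    rw [Real.dist_eq, sub_zero]
    simp only [ge_iff_le, max_le_iff] at hn
    exact h (hN3 n hn.2.1) (hN1 n hn.1.1) (hN4 n hn.2.2) (hN2 n hn.1.2)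
  have := hdiff.add hL
  simpa using this

lemma zero_limit {D : ℝ → ℝ → ℝ → ℝ → ℝ} {C θ : ℝ} (hθ : 1 < θ) (hC : 0 ≤ C)
    (hD : ZeroCond θ C D) {a b c d : ℝ} (hab : b - a ≤ 1) (hcd : d - c ≤ 1)
    {m m' : ℕ → ℕ} {σ τ : ℕ → ℕ → ℝ} (hσ : MSeq a b m σ) (hτ : MSeq c d m' τ) :
    Tendsto (fun n => dsum D (m n) (m' n) (σ n) (τ n)) atTop (𝓝 0) := by
  obtain ⟨M, hM, hz⟩ := dsum_zero hθ hC hD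
  rw [Metric.tendsto_atTop]
  intro η hη
  obtain ⟨ε, hε, h⟩ := small_rpow (M := M) (p := θ - 1) (by linarith) hη
  obtain ⟨N3, hN3⟩ := hσ ε hε
  obtain ⟨N4, hN4⟩ := hτ ε hε
  refine ⟨max N3 N4, fun n hn => ?_⟩
  rw [Real.dist_eq, sub_zero]
  simp only [ge_iff_le, max_le_iff] at hn
  exact (hz hab hcd hε.le (hN3 n hn.1) (hN4 n hn.2)).trans_lt h

lemma IsPartSeq.mem {a b : ℝ} {m : ℕ → ℕ} {σ : ℕ → ℕ → ℝ} (h : IsPartSeq a b m σ)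
    (ha : a ∈ I01) (hb : b ∈ I01) (n k : ℕ) (hk : k ≤ m n) : σ n k ∈ I01 := by
  obtain ⟨h0, h1, h2, h3⟩ := h
  have hmono : Monotone (fun k => σ n (min k (m n))) := by
    apply monotone_nat_of_le_succ
    intro k
    show σ n (min k (m n)) ≤ σ n (min (k + 1) (m n))
    rcases lt_or_ge k (m n) with hk | hk
    · rw [min_eq_left hk.le, min_eq_left (by omega)]
      exact (h2 n k hk).le
    · rw [min_eq_right hk, min_eq_right (by omega)]
  have e1 := hmono (Nat.zero_le k)
  have e2 := hmono hk
  simp only [Nat.zero_min, min_self, min_eq_left hk, h0, h1] at e1 e2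
  unfold I01 at *
  exact ⟨ha.1.trans e1, e2.trans hb.2⟩

/-- Transfer of a double sum to the clamped, monotone setting. -/
lemma sum_transfer {s1 s2 t1 t2 : ℝ} (hs1 : s1 ∈ I01) (hs2 : s2 ∈ I01) (ht1 : t1 ∈ I01)
    (ht2 : t2 ∈ I01) {m m' : ℕ → ℕ} {σ τ : ℕ → ℕ → ℝ}
    (hσ : IsPartSeq s1 s2 m σ) (hτ : IsPartSeq t1 t2 m' τ) {A B : ℝ → ℝ → ℝ → ℝ → ℝ}
    (hAB : ∀ s ∈ I01, ∀ s' ∈ I01, ∀ t ∈ I01, ∀ t' ∈ I01, A s s' t t' = B s s' t t') (n : ℕ) :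
    ∑ i ∈ Finset.range (m n), ∑ j ∈ Finset.range (m' n),
      A (σ n i) (σ n (i + 1)) (τ n j) (τ n (j + 1))
    = dsum B (m n) (m' n) (fun k => σ n (min k (m n))) (fun k => τ n (min k (m' n))) := by
  unfold dsum
  refine Finset.sum_congr rfl fun i hi => Finset.sum_congr rfl fun j hj => ?_
  rw [Finset.mem_range] at hi hj
  have e1 : min (i + 1) (m n) = i + 1 := min_eq_left (by omega)
  have e2 : min (j + 1) (m' n) = j + 1 := min_eq_left (by omega)
  simp only [min_eq_left hi.le, min_eq_left hj.le, e1, e2]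
  exact hAB _ (hσ.mem hs1 hs2 n i hi.le) _ (hσ.mem hs1 hs2 n (i + 1) hi) _
    (hτ.mem ht1 ht2 n j hj.le) _ (hτ.mem ht1 ht2 n (j + 1) hj)

lemma dsum_add (A B : ℝ → ℝ → ℝ → ℝ → ℝ) (m m' : ℕ) (σ τ : ℕ → ℝ) :
    dsum (fun s s' t t' => A s s' t t' + B s s' t t') m m' σ τ
      = dsum A m m' σ τ + dsum B m m' σ τ := by
  unfold dsum
  simp only [Finset.sum_add_distrib]

theorem riemann_sum_representations_mixed_integral
    (γ1 γ2 : ℝ) (hγ1 : 1 / 2 < γ1) (hγ2 : 1 / 2 < γ2)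
    (x : ℝ → ℝ → ℝ)
    (hxc : ContinuousOn (fun p : ℝ × ℝ => x p.1 p.2) (I01 ×ˢ I01))
    (hxN : NN γ1 γ2 x ≠ ⊤)
    (φ : ℝ → ℝ) (hφ : ContDiff ℝ 2 φ) :
    ∃ z2y zd : ℝ → ℝ → ℝ → ℝ → ℝ,
      ∀ s1 ∈ I01, ∀ s2 ∈ I01, ∀ t1 ∈ I01, ∀ t2 ∈ I01, s1 ≤ s2 → t1 ≤ t2 →
        ∀ (m m' : ℕ → ℕ) (σ τ : ℕ → ℕ → ℝ),
          IsPartSeq s1 s2 m σ → IsPartSeq t1 t2 m' τ →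
          Tendsto (fun n => ∑ i ∈ Finset.range (m n), ∑ j ∈ Finset.range (m' n),
              φ (x (σ n i) (τ n j)) * d1 x (σ n i) (σ n (i + 1)) (τ n j) *
                d2 x (σ n (i + 1)) (τ n j) (τ n (j + 1)))
            atTop (𝓝 (z2y s1 s2 t1 t2)) ∧
          Tendsto (fun n => ∑ i ∈ Finset.range (m n), ∑ j ∈ Finset.range (m' n),
              φ (x (σ n i) (τ n j)) * d2 x (σ n i) (τ n j) (τ n (j + 1)) *
                d1 x (σ n i) (σ n (i + 1)) (τ n (j + 1)))
            atTop (𝓝 (z2y s1 s2 t1 t2)) ∧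
          Tendsto (fun n => ∑ i ∈ Finset.range (m n), ∑ j ∈ Finset.range (m' n),
              φ (x (σ n i) (τ n j)) * d1 x (σ n i) (σ n (i + 1)) (τ n j) *
                d2 x (σ n i) (τ n j) (τ n (j + 1)))
            atTop (𝓝 (z2y s1 s2 t1 t2)) ∧
          Tendsto (fun n => ∑ i ∈ Finset.range (m n), ∑ j ∈ Finset.range (m' n),
              φ (x (σ n i) (τ n j)) *
                dRect x (σ n i) (σ n (i + 1)) (τ n j) (τ n (j + 1)))
            atTop (𝓝 (zd s1 s2 t1 t2)) := by
  set γ := min γ1 γ2 with hγdef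
  have hγ : 1 / 2 < γ := lt_min hγ1 hγ2
  have hγ0 : 0 < γ := by linarith
  have hθ : 1 < 2 * γ := by linarith
  obtain ⟨X, hXd⟩ : ∃ X : ℝ → ℝ → ℝ, X = fun s t => x (clp s) (clp t) := ⟨_, rfl⟩
  have hX0 := hol_of_NN hγ0 (min_le_left γ1 γ2) (min_le_right γ1 γ2) hxN
  rw [← hXd] at hX0
  obtain ⟨M', hY0⟩ := hX0.comp hφ
  obtain ⟨Y, hYd⟩ : ∃ Y : ℝ → ℝ → ℝ, Y = fun s t => φ (X s t) := ⟨_, rfl⟩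
  rw [← hYd] at hY0
  obtain ⟨M, hMd⟩ : ∃ M, M = max (NN γ1 γ2 x).toReal M' := ⟨_, rfl⟩
  have hX : Hol γ M X := hX0.mono (hMd ▸ le_max_left _ _)
  have hY : Hol γ M Y := hY0.mono (hMd ▸ le_max_right _ _)
  have hM := hX.n
  have hXe : ∀ s ∈ I01, ∀ t ∈ I01, X s t = x s t := by
    intro s hs t ht
    rw [hXd]; simp only [clp_eq hs, clp_eq ht]
  have hYe : ∀ s ∈ I01, ∀ t ∈ I01, Y s t = φ (x s t) := by
    intro s hs t ht
    rw [hYd]; simp only [hXe s hs t ht]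
  have S3 := germ3_sew hγ0 hX hY
  have S3' : SewCond (2 * γ) (4 * M ^ 3) (fun t t' s s' => germ3 X Y s s' t t') := by
    have := germ3_sew hγ0 hX.flip hY.flip
    convert this using 5
    unfold germ3; ring
  have S4 := germ4_sew hγ0 hX hY
  have S4' : SewCond (2 * γ) (2 * M ^ 2) (fun t t' s s' => germ4 X Y s s' t t') := by
    have := germ4_sew hγ0 hX.flip hY.flip
    convert this using 5
    unfold germ4; ring
  have Z1 := germD_zero hγ0 hX hY
  have Z2 := germD_zero hγ0 hX.flip hY.flip
  have E3 : ∀ a b c d : ℝ, ∃ L : ℝ, b - a ≤ 1 → d - c ≤ 1 → ∀ m m' σ τ, MSeq a b m σ →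
      MSeq c d m' τ →
      Tendsto (fun n => dsum (germ3 X Y) (m n) (m' n) (σ n) (τ n)) atTop (𝓝 L) := by
    intro a b c d
    by_cases h : b - a ≤ 1 ∧ d - c ≤ 1
    · obtain ⟨L, hL⟩ := exists_limit hθ (by positivity) S3 S3' h.1 h.2
      exact ⟨L, fun _ _ => hL⟩
    · exact ⟨0, fun h1 h2 => absurd ⟨h1, h2⟩ h⟩
  have E4 : ∀ a b c d : ℝ, ∃ L : ℝ, b - a ≤ 1 → d - c ≤ 1 → ∀ m m' σ τ, MSeq a b m σ →
      MSeq c d m' τ →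
      Tendsto (fun n => dsum (germ4 X Y) (m n) (m' n) (σ n) (τ n)) atTop (𝓝 L) := by
    intro a b c d
    by_cases h : b - a ≤ 1 ∧ d - c ≤ 1
    · obtain ⟨L, hL⟩ := exists_limit hθ (by positivity) S4 S4' h.1 h.2
      exact ⟨L, fun _ _ => hL⟩
    · exact ⟨0, fun h1 h2 => absurd ⟨h1, h2⟩ h⟩
  choose z2y hz2y using E3
  choose zd hzd using E4
  refine ⟨z2y, zd, ?_⟩
  intro s1 hs1 s2 hs2 t1 ht1 t2 ht2 _ _ m m' σ τ hσ hτ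
  have hab : s2 - s1 ≤ 1 := by
    have a := hs1.1
    have b := hs2.2
    linarith
  have hcd : t2 - t1 ≤ 1 := by
    have a := ht1.1
    have b := ht2.2
    linarith
  have T3 := hz2y s1 s2 t1 t2 hab hcd _ _ _ _ hσ.mseq hτ.mseq
  have T4 := hzd s1 s2 t1 t2 hab hcd _ _ _ _ hσ.mseq hτ.mseq
  have D1 := zero_limit hθ (by positivity) Z1 hab hcd hσ.mseq hτ.mseq
  have D2 := zero_limit hθ (by positivity) Z2 hcd hab hτ.mseq hσ.mseq
  have T1 := T3.add D1
  have T2 := T3.add D2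
  rw [add_zero] at T1 T2
  refine ⟨T1.congr fun n => ?_, T2.congr fun n => ?_, T3.congr fun n => ?_, T4.congr fun n => ?_⟩
  · rw [← dsum_add]
    refine (sum_transfer (A := fun s s' t t' => φ (x s t) * d1 x s s' t * d2 x s' t t')
      hs1 hs2 ht1 ht2 hσ hτ ?_ n).symm
    intro s hs s' hs' t ht t' ht'
    simp only [germ3, germD, d1, d2, hXe s hs t ht, hXe s' hs' t ht, hXe s hs t' ht',
      hXe s' hs' t' ht', hYe s hs t ht]
    ring
  · rw [← dsum_flip (germD _ _), ← dsum_add]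
    refine (sum_transfer (A := fun s s' t t' => φ (x s t) * d2 x s t t' * d1 x s s' t')
      hs1 hs2 ht1 ht2 hσ hτ ?_ n).symm
    intro s hs s' hs' t ht t' ht'
    simp only [germ3, germD, d1, d2, hXe s hs t ht, hXe s' hs' t ht, hXe s hs t' ht',
      hXe s' hs' t' ht', hYe s hs t ht]
    ring
  · refine (sum_transfer (A := fun s s' t t' => φ (x s t) * d1 x s s' t * d2 x s t t')
      hs1 hs2 ht1 ht2 hσ hτ ?_ n).symm
    intro s hs s' hs' t ht t' ht'
    simp only [germ3, d1, d2, hXe s hs t ht, hXe s' hs' t ht, hXe s hs t' ht',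
      hYe s hs t ht]
  · refine (sum_transfer (A := fun s s' t t' => φ (x s t) * dRect x s s' t t')
      hs1 hs2 ht1 ht2 hσ hτ ?_ n).symm
    intro s hs s' hs' t ht t' ht'
    simp only [germ4, dRect, hXe s hs t ht, hXe s' hs' t ht, hXe s hs t' ht',
      hXe s' hs' t' ht', hYe s hs t ht]
end
end

section
/- (Mixed planar Young integrals with three different drivers.) Let f, g, h : [0,1]^2 → ℝ be continuous with N_{γ_1,γ_2}(f) < ∞, N_{ρ_1,ρ_2}(g) < ∞ and N_{β_1,β_2}(h) < ∞, where the exponents lie in (0,1) and satisfy γ_i + ρ_i > 1, β_i + γ_i > 1 and β_i + ρ_i > 1 for i = 1,2. Then for every rectangle [s_1,s_2] × [t_1,t_2] ⊆ [0,1]^2 and every sequence of grid partitions with mesh tending to 0, the Riemann sums Σ_{i,j} f(σ_i,τ_j) δ_1 g_{σ_i σ_{i+1};τ_j} δ_2 h_{σ_{i+1};τ_j τ_{j+1}} and Σ_{i,j} f(σ_i,τ_j) δ_1 g_{σ_i σ_{i+1};τ_j} δ_2 h_{σ_i;τ_j τ_{j+1}} both converge, and they converge to the same limit (which defines the mixed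 Young integral of f with respect to d_1 g d_2 h over the rectangle). -/
open Set Filter
open scoped ENNReal Topology

noncomputable section

lemma pt_mono {m : ℕ} {σ : ℕ → ℝ} (h : ∀ i < m, σ i ≤ σ (i + 1)) {i j : ℕ} (hij : i ≤ j) (hj : j ≤ m) :
    σ i ≤ σ j := by
  induction j, hij using Nat.le_induction with
  | base => exact le_rfl
  | succ k hk ih => exact (ih (by omega)).trans (h k (by omega))

lemma sew (θ : ℝ) (hθ : 1 < θ) : ∃ C : ℝ, 0 ≤ C ∧ ∀ (A : ℝ → ℝ → ℝ) (K : ℝ), 0 ≤ K →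
    (∀ s v u, 0 ≤ s → s ≤ v → v ≤ u → u ≤ 1 → |A s u - A s v - A v u| ≤ K * (u - s) ^ θ) →
    ∀ (n : ℕ) (σ : ℕ → ℝ), (∀ i < n, σ i ≤ σ (i + 1)) → 0 ≤ σ 0 → σ n ≤ 1 →
      |A (σ 0) (σ n) - ∑ i ∈ Finset.range n, A (σ i) (σ (i + 1))| ≤ C * K * (σ n - σ 0) ^ θ := by
  set r : ℝ := (1 / 2 : ℝ) ^ θ with hr
  have hr0 : 0 < r := by positivity
  have hr1 : r < 1 / 2 := by
    have := Real.rpow_lt_rpow_of_exponent_gt (x := (1/2 : ℝ)) (by norm_num) (by norm_num) hθ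
    simpa [hr] using this
  have hd : 0 < 1 - 2 * r := by linarith
  refine ⟨2 / (1 - 2 * r), by positivity, ?_⟩
  set C : ℝ := 2 / (1 - 2 * r) with hC
  have hC0 : 0 ≤ C := by positivity
  have hCe : 2 + 2 * C * r = C := by rw [hC]; field_simp; ring
  intro A K hK hA n
  induction n using Nat.strong_induction_on with
  | _ n ih =>
  intro σ hσ h0 h1
  rcases Nat.eq_zero_or_pos n with rfl | hn
  · have := hA (σ 0) (σ 0) (σ 0) h0 le_rfl le_rfl h1
    rw [sub_self, sub_self, Real.zero_rpow (by linarith)] at this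
    have h2 : A (σ 0) (σ 0) = 0 := by
      simpa using this
    simp [h2, Real.zero_rpow (show θ ≠ 0 by linarith)]
  have hL : σ 0 ≤ σ n := pt_mono hσ (Nat.zero_le _) le_rfl
  set L := σ n - σ 0 with hLd
  have hex : ∃ k, L / 2 ≤ σ (k + 1) - σ 0 := ⟨n - 1, by
    rw [Nat.sub_add_cancel hn]; linarith⟩
  classical
  obtain ⟨k, hk, hkmin⟩ : ∃ k, L / 2 ≤ σ (k + 1) - σ 0 ∧ ∀ j < k, ¬ (L / 2 ≤ σ (j + 1) - σ 0) :=
    ⟨Nat.find hex, Nat.find_spec hex, fun j hj => Nat.find_min hex hj⟩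
  have hkn : k < n := by
    by_contra hcon
    apply hkmin (n - 1) (by omega)
    rw [Nat.sub_add_cancel hn]; linarith
  have hk2 : σ k - σ 0 ≤ L / 2 := by
    rcases Nat.eq_zero_or_pos k with rfl | hkp
    · linarith
    · have := hkmin (k - 1) (by omega)
      rw [Nat.sub_add_cancel hkp] at this
      linarith
  have m0k : σ 0 ≤ σ k := pt_mono hσ (Nat.zero_le _) (by omega)
  have mk1 : σ k ≤ σ (k + 1) := hσ k hkn
  have mkn : σ (k + 1) ≤ σ n := pt_mono hσ (by omega) le_rfl
  have e1 := hA (σ 0) (σ k) (σ n) h0 m0k (by linarith) h1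
  have e2 := hA (σ k) (σ (k + 1)) (σ n) (by linarith) mk1 mkn h1
  have i1 := ih k hkn σ (fun i hi => hσ i (by omega)) h0 (by linarith)
  have i2 := ih (n - (k + 1)) (by omega) (fun i => σ (k + 1 + i))
    (fun i hi => hσ (k + 1 + i) (by omega)) (by simp only [add_zero]; linarith)
    (by rw [show k + 1 + (n - (k + 1)) = n by omega]; exact h1)
  simp only [add_zero] at i2
  rw [show k + 1 + (n - (k + 1)) = n by omega] at i2
  have hsum : ∑ i ∈ Finset.range n, A (σ i) (σ (i + 1)) =
      ∑ i ∈ Finset.range k, A (σ i) (σ (i + 1)) + A (σ k) (σ (k + 1)) +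
      ∑ i ∈ Finset.range (n - (k + 1)), A (σ (k + 1 + i)) (σ (k + 1 + (i + 1))) := by
    rw [← Finset.sum_range_succ]
    conv_lhs => rw [show n = (k + 1) + (n - (k + 1)) by omega, Finset.sum_range_add]
    rfl
  have hhalf : (L / 2) ^ θ = L ^ θ * r := by
    rw [hr, ← Real.mul_rpow (by linarith) (by norm_num)]; congr 1; ring
  have b1 : (σ k - σ 0) ^ θ ≤ L ^ θ * r := by
    rw [← hhalf]; exact Real.rpow_le_rpow (by linarith) hk2 (by linarith)
  have b2 : (σ n - σ (k + 1)) ^ θ ≤ L ^ θ * r := by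
    rw [← hhalf]; exact Real.rpow_le_rpow (by linarith) (by linarith) (by linarith)
  have b3 : (σ n - σ k) ^ θ ≤ L ^ θ := Real.rpow_le_rpow (by linarith) (by linarith) (by linarith)
  have c1 := mul_le_mul_of_nonneg_left b1 (mul_nonneg hC0 hK)
  have c2 := mul_le_mul_of_nonneg_left b2 (mul_nonneg hC0 hK)
  have c3 := mul_le_mul_of_nonneg_left b3 hK
  have hfin : C * K * L ^ θ = 2 * (K * L ^ θ) + 2 * (C * K * (L ^ θ * r)) := by
    conv_lhs => rw [← hCe]
    ring
  rw [hsum, hfin]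
  rw [abs_le] at *
  constructor <;> linarith [e1.1, e1.2, e2.1, e2.2, i1.1, i1.2, i2.1, i2.2]

lemma clamp_symm (A : ℝ → ℝ → ℝ) (h0 : ∀ x, 0 ≤ x → x ≤ 1 → A x x = 0) (a b c d : ℝ)
    (hab : a ≤ b) (hcd : c ≤ d) (ha : 0 ≤ a) (hc : 0 ≤ c) (hb : b ≤ 1) (hd : d ≤ 1) :
    A (max a (min b c)) (max a (min b d)) = A (max c (min d a)) (max c (min d b)) := by
  rcases le_total b c with h | h
  · rw [min_eq_left h, min_eq_left (h.trans hcd), max_eq_right hab, min_eq_right (by linarith),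
      min_eq_right (by linarith), max_eq_left h, max_eq_left (by linarith), h0 _ (by linarith) hb,
      h0 _ hc (by linarith)]
  rcases le_total d a with h' | h'
  · rw [min_eq_right h, min_eq_right (h'.trans hab), max_eq_left (by linarith), max_eq_left h',
      min_eq_left h', min_eq_left (by linarith), max_eq_right hcd, h0 _ (by linarith) (by linarith),
      h0 _ (by linarith) hd]
  rw [min_eq_right h, min_eq_right h', max_comm a c, max_eq_right (le_min hab h'),
    max_eq_right (le_min hcd h), min_comm]

lemma refine_cmp (θ : ℝ) (hθ : 1 < θ) : ∃ C : ℝ, 0 ≤ C ∧ ∀ (A : ℝ → ℝ → ℝ) (K : ℝ), 0 ≤ K →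
    (∀ s v u, 0 ≤ s → s ≤ v → v ≤ u → u ≤ 1 → |A s u - A s v - A v u| ≤ K * (u - s) ^ θ) →
    ∀ (n n' : ℕ) (σ σ' : ℕ → ℝ), (∀ i < n, σ i ≤ σ (i + 1)) → (∀ i < n', σ' i ≤ σ' (i + 1)) →
      0 ≤ σ 0 → σ n ≤ 1 → σ 0 = σ' 0 → σ n = σ' n' →
      |∑ i ∈ Finset.range n, A (σ i) (σ (i + 1)) - ∑ i ∈ Finset.range n', A (σ' i) (σ' (i + 1))| ≤
       C * K * (∑ i ∈ Finset.range n, (σ (i + 1) - σ i) ^ θ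
        + ∑ i ∈ Finset.range n', (σ' (i + 1) - σ' i) ^ θ) := by
  obtain ⟨C, hC, H⟩ := sew θ hθ
  refine ⟨C, hC, ?_⟩
  intro A K hK hA
  have key : ∀ (n n' : ℕ) (σ σ' : ℕ → ℝ), (∀ i < n, σ i ≤ σ (i + 1)) →
      (∀ i < n', σ' i ≤ σ' (i + 1)) →
      0 ≤ σ 0 → σ n ≤ 1 → σ 0 = σ' 0 → σ n = σ' n' →
      |∑ i ∈ Finset.range n, A (σ i) (σ (i + 1)) -
        ∑ i ∈ Finset.range n, ∑ j ∈ Finset.range n',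
          A (max (σ i) (min (σ (i + 1)) (σ' j))) (max (σ i) (min (σ (i + 1)) (σ' (j + 1))))| ≤
       C * K * ∑ i ∈ Finset.range n, (σ (i + 1) - σ i) ^ θ := by
    intro n n' σ σ' hσ hσ' h0 h1 he he'
    rw [← Finset.sum_sub_distrib, Finset.mul_sum]
    refine (Finset.abs_sum_le_sum_abs _ _).trans (Finset.sum_le_sum fun i hi => ?_)
    have hi := Finset.mem_range.1 hi
    have p1 : σ 0 ≤ σ i := pt_mono hσ (Nat.zero_le _) hi.le
    have p2 : σ (i + 1) ≤ σ n := pt_mono hσ hi le_rfl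
    have p3 := hσ i hi
    have := H A K hK hA n' (fun j => max (σ i) (min (σ (i + 1)) (σ' j)))
      (fun j hj => max_le_max le_rfl (min_le_min le_rfl (hσ' j hj)))
      (by exact (h0.trans p1).trans (le_max_left _ _))
      (by exact max_le (by linarith) ((min_le_left _ _).trans (by linarith)))
    beta_reduce at this
    rw [← he, ← he', min_eq_right (p1.trans p3), max_eq_left p1, min_eq_left p2,
      max_eq_right p3] at this
    exact this
  intro n n' σ σ' hσ hσ' h0 h1 he he'
  have k1 := key n n' σ σ' hσ hσ' h0 h1 he he'
  have k2 := key n' n σ' σ hσ' hσ (he ▸ h0) (he' ▸ h1) he.symm he'.symm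
  have hz : ∀ x, 0 ≤ x → x ≤ 1 → A x x = 0 := by
    intro x hx hx'
    have := hA x x x hx le_rfl le_rfl hx'
    rw [sub_self, sub_self, Real.zero_rpow (by linarith)] at this
    simpa using this
  rw [Finset.sum_comm] at k2
  have hs : ∑ i ∈ Finset.range n, ∑ j ∈ Finset.range n',
          A (max (σ i) (min (σ (i + 1)) (σ' j))) (max (σ i) (min (σ (i + 1)) (σ' (j + 1)))) =
      ∑ i ∈ Finset.range n, ∑ j ∈ Finset.range n',
          A (max (σ' j) (min (σ' (j + 1)) (σ i))) (max (σ' j) (min (σ' (j + 1)) (σ (i + 1)))) := by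
    refine Finset.sum_congr rfl fun i hi => Finset.sum_congr rfl fun j hj => ?_
    have hi := Finset.mem_range.1 hi
    have hj := Finset.mem_range.1 hj
    have p1 : σ 0 ≤ σ i := pt_mono hσ (Nat.zero_le _) hi.le
    have p2 : σ (i + 1) ≤ σ n := pt_mono hσ hi le_rfl
    have q1 : σ' 0 ≤ σ' j := pt_mono hσ' (Nat.zero_le _) hj.le
    have q2 : σ' (j + 1) ≤ σ' n' := pt_mono hσ' hj le_rfl
    exact clamp_symm A hz _ _ _ _ (hσ i hi) (hσ' j hj) (by linarith) (by linarith) (by linarith)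
      (by linarith)
  rw [hs] at k1
  rw [mul_add]
  rw [abs_le] at *
  constructor <;> linarith [k1.1, k1.2, k2.1, k2.2]

/-- Hölder bound on the unit interval. -/
def Hol_s10 (e K : ℝ) (p : ℝ → ℝ) : Prop :=
  ∀ x y, 0 ≤ x → x ≤ y → y ≤ 1 → |p y - p x| ≤ K * (y - x) ^ e

/-- Sup bound on the unit interval. -/
def Bd (K : ℝ) (p : ℝ → ℝ) : Prop := ∀ x, 0 ≤ x → x ≤ 1 → |p x| ≤ K

lemma rpow_split_le {s v u a b : ℝ} (ha : 0 < a) (hb : 0 < b) (h1 : s ≤ v) (h2 : v ≤ u) :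
    (v - s) ^ a * (u - v) ^ b ≤ (u - s) ^ (a + b) := by
  rw [Real.rpow_add_of_nonneg (by linarith) ha.le hb.le]
  exact mul_le_mul (Real.rpow_le_rpow (by linarith) (by linarith) ha.le)
    (Real.rpow_le_rpow (by linarith) (by linarith) hb.le) (Real.rpow_nonneg (by linarith) _)
    (Real.rpow_nonneg (by linarith) _)

lemma rpow_le_of_exp {x a b : ℝ} (hx : 0 ≤ x) (hx1 : x ≤ 1) (hb : 0 < b) (h : b ≤ a) :
    x ^ a ≤ x ^ b := by
  rcases hx.eq_or_lt with rfl | h0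
  · rw [Real.zero_rpow (by linarith), Real.zero_rpow (by linarith)]
  · exact Real.rpow_le_rpow_of_exponent_ge h0 hx1 h

/-- Uniform discrete Young bound. -/
lemma young (e1 e2 e3 : ℝ) (h1 : 0 < e1) (h2 : 0 < e2) (h3 : 0 < e3) (h13 : 1 < e1 + e3)
    (h23 : 1 < e2 + e3) : ∃ C : ℝ, 0 ≤ C ∧ ∀ (p q b : ℝ → ℝ) (K1 K2 K3 : ℝ), 0 ≤ K1 → 0 ≤ K2 → 0 ≤ K3 →
    Bd K1 p → Hol_s10 e1 K1 p → Bd K2 q → Hol_s10 e2 K2 q → Hol_s10 e3 K3 b →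
    ∀ (n : ℕ) (τ : ℕ → ℝ), (∀ i < n, τ i ≤ τ (i + 1)) → 0 ≤ τ 0 → τ n ≤ 1 →
     |∑ j ∈ Finset.range n, p (τ j) * q (τ j) * (b (τ (j + 1)) - b (τ j))| ≤ C * (K1 * K2 * K3) := by
  have he : 0 < min e1 e2 := lt_min h1 h2
  obtain ⟨C, hC, H⟩ := sew (min e1 e2 + e3) (by rw [← min_add_add_right]; exact lt_min h13 h23)
  refine ⟨1 + 2 * C, by positivity, ?_⟩
  intro p q b K1 K2 K3 hK1 hK2 hK3 bp hp bq hq hb n τ hτ h0 hn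
  have hm : τ 0 ≤ τ n := pt_mono hτ (Nat.zero_le _) le_rfl
  have hA := H (fun s u => p s * q s * (b u - b s)) (2 * (K1 * K2 * K3)) (by positivity) (by
    intro s v u hs hsv hvu hu
    have e : p s * q s * (b u - b s) - p s * q s * (b v - b s) - p v * q v * (b u - b v)
        = -(((p v - p s) * q v + p s * (q v - q s)) * (b u - b v)) := by ring
    rw [e, abs_neg, abs_mul]
    have x1 : |p v - p s| ≤ K1 * (v - s) ^ (min e1 e2) := (hp s v hs hsv (by linarith)).trans
      (mul_le_mul_of_nonneg_left
        (rpow_le_of_exp (by linarith) (by linarith) he (min_le_left _ _)) hK1)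
    have x2 : |q v - q s| ≤ K2 * (v - s) ^ (min e1 e2) := (hq s v hs hsv (by linarith)).trans
      (mul_le_mul_of_nonneg_left
        (rpow_le_of_exp (by linarith) (by linarith) he (min_le_right _ _)) hK2)
    have x3 := hb v u (by linarith) hvu hu
    have y1 := bp s hs (by linarith)
    have y2 := bq v (by linarith) (by linarith)
    have hw : 0 ≤ (v - s) ^ (min e1 e2) := Real.rpow_nonneg (by linarith) _
    have hw' : 0 ≤ (u - v) ^ e3 := Real.rpow_nonneg (by linarith) _
    have z1 : |(p v - p s) * q v + p s * (q v - q s)| ≤ 2 * (K1 * K2) * (v - s) ^ (min e1 e2) := by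
      refine (abs_add_le _ _).trans ?_
      rw [abs_mul, abs_mul]
      have := mul_le_mul x1 y2 (abs_nonneg _) (by positivity)
      have := mul_le_mul y1 x2 (abs_nonneg _) (by positivity)
      linarith
    calc _ ≤ (2 * (K1 * K2) * (v - s) ^ (min e1 e2)) * (K3 * (u - v) ^ e3) :=
          mul_le_mul z1 x3 (abs_nonneg _) (by positivity)
      _ = 2 * (K1 * K2 * K3) * ((v - s) ^ (min e1 e2) * (u - v) ^ e3) := by ring
      _ ≤ _ := mul_le_mul_of_nonneg_left (rpow_split_le he h3 hsv hvu) (by positivity)) n τ hτ h0 hn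
  have w : ∀ x : ℝ, 0 < x → (τ n - τ 0) ^ x ≤ 1 := fun x hx =>
    Real.rpow_le_one (by linarith) (by linarith) hx.le
  have hA' := hA.trans (mul_le_mul_of_nonneg_left (w _ (by linarith)) (by positivity))
  have hB : |p (τ 0) * q (τ 0) * (b (τ n) - b (τ 0))| ≤ K1 * K2 * K3 := by
    rw [abs_mul, abs_mul]
    have y3 : |b (τ n) - b (τ 0)| ≤ K3 := (hb _ _ h0 hm hn).trans (by
      have := mul_le_mul_of_nonneg_left (w e3 h3) hK3
      linarith)
    have y1 := bp (τ 0) h0 (by linarith)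
    have y2 := bq (τ 0) h0 (by linarith)
    gcongr
  rw [abs_le] at *
  constructor <;> linarith [hA'.1, hA'.2, hB.1, hB.2]

/-- Real-valued form of finiteness of `NN`. -/
structure Reg (a1 a2 K : ℝ) (f : ℝ → ℝ → ℝ) : Prop where
  nn : 0 ≤ K
  bd : ∀ s ∈ I01, ∀ t ∈ I01, |f s t| ≤ K
  h1 : ∀ s ∈ I01, ∀ s' ∈ I01, ∀ t ∈ I01, s ≤ s' → |f s' t - f s t| ≤ K * (s' - s) ^ a1
  h2 : ∀ s ∈ I01, ∀ t ∈ I01, ∀ t' ∈ I01, t ≤ t' → |f s t' - f s t| ≤ K * (t' - t) ^ a2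
  hr : ∀ s ∈ I01, ∀ s' ∈ I01, ∀ t ∈ I01, ∀ t' ∈ I01, s ≤ s' → t ≤ t' →
    |(f s' t' - f s t') - (f s' t - f s t)| ≤ K * (s' - s) ^ a1 * (t' - t) ^ a2

lemma Reg.swap {a1 a2 K : ℝ} {f : ℝ → ℝ → ℝ} (h : Reg a1 a2 K f) : Reg a2 a1 K (fun t s => f s t) where
  nn := h.nn
  bd := fun t ht s hs => h.bd s hs t ht
  h1 := fun t ht t' ht' s hs hle => h.h2 s hs t ht t' ht' hle
  h2 := fun t ht s hs s' hs' hle => h.h1 s hs s' hs' t ht hle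
  hr := fun t ht t' ht' s hs s' hs' hle hle' => by
    have := h.hr s hs s' hs' t ht t' ht' hle' hle
    rw [show f s' t' - f s' t - (f s t' - f s t) = f s' t' - f s t' - (f s' t - f s t) by ring]
    linarith

lemma reg_of_NN {a1 a2 : ℝ} (f : ℝ → ℝ → ℝ) (h1 : 0 < a1) (h2 : 0 < a2) (h : NN a1 a2 f ≠ ⊤) :
    ∃ K, Reg a1 a2 K f := by
  have key : ∀ x w : ℝ, 0 ≤ w → (w = 0 → x = 0) → ENNReal.ofReal (|x| / w) ≤ NN a1 a2 f →
      |x| ≤ (NN a1 a2 f).toReal * w := by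
    intro x w hw hx hle
    rcases hw.eq_or_lt with h0 | h0
    · simp [hx h0.symm, ← h0]
    · rw [← div_le_iff₀ h0]
      exact (ENNReal.ofReal_le_iff_le_toReal h).1 hle
  have n1 : holRect a1 a2 f ≤ NN a1 a2 f := by
    unfold NN; exact le_add_right (le_add_right (le_add_right le_rfl))
  have n2 : hol1 a1 f ≤ NN a1 a2 f := by
    unfold NN; exact le_add_right (le_add_right (le_add_left le_rfl))
  have n3 : hol2 a2 f ≤ NN a1 a2 f := by
    unfold NN; exact le_add_right (le_add_left le_rfl)
  have n4 : holInf f ≤ NN a1 a2 f := by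
    unfold NN; exact le_add_left le_rfl
  refine ⟨(NN a1 a2 f).toReal, ENNReal.toReal_nonneg, ?_, ?_, ?_, ?_⟩
  · intro s hs t ht
    refine (ENNReal.ofReal_le_iff_le_toReal h).1 (le_trans ?_ n4)
    exact le_iSup_of_le ⟨s, hs⟩ (le_iSup_of_le ⟨t, ht⟩ le_rfl)
  · intro s hs s' hs' t ht hle
    have hz : 0 ≤ s' - s := by linarith
    refine key _ _ (Real.rpow_nonneg hz _) ?_ (le_trans ?_ n2)
    · intro hw
      have : s' = s := by linarith [(Real.rpow_eq_zero hz h1.ne').1 hw]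
      rw [this, sub_self]
    · refine le_iSup_of_le ⟨s, hs⟩ (le_iSup_of_le ⟨s', hs'⟩ (le_iSup_of_le ⟨t, ht⟩ ?_))
      simp only [d1, abs_of_nonneg hz, le_refl]
  · intro s hs t ht t' ht' hle
    have hz : 0 ≤ t' - t := by linarith
    refine key _ _ (Real.rpow_nonneg hz _) ?_ (le_trans ?_ n3)
    · intro hw
      have : t' = t := by linarith [(Real.rpow_eq_zero hz h2.ne').1 hw]
      rw [this, sub_self]
    · refine le_iSup_of_le ⟨s, hs⟩ (le_iSup_of_le ⟨t, ht⟩ (le_iSup_of_le ⟨t', ht'⟩ ?_))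
      simp only [d2, abs_of_nonneg hz, le_refl]
  · intro s hs s' hs' t ht t' ht' hle hle'
    have hz : 0 ≤ s' - s := by linarith
    have hz' : 0 ≤ t' - t := by linarith
    rw [mul_assoc]
    refine key _ _ (mul_nonneg (Real.rpow_nonneg hz _) (Real.rpow_nonneg hz' _)) ?_ (le_trans ?_ n1)
    · intro hw
      rcases mul_eq_zero.1 hw with hw | hw
      · have : s' = s := by linarith [(Real.rpow_eq_zero hz h1.ne').1 hw]
        rw [this]; ring
      · have : t' = t := by linarith [(Real.rpow_eq_zero hz' h2.ne').1 hw]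
        rw [this]; ring
    · refine le_iSup_of_le ⟨s, hs⟩ (le_iSup_of_le ⟨s', hs'⟩ (le_iSup_of_le ⟨t, ht⟩
        (le_iSup_of_le ⟨t', ht'⟩ ?_)))
      simp only [dRect, abs_of_nonneg hz, abs_of_nonneg hz']
      rw [show f s' t' - f s t' - (f s' t - f s t) = f s' t' - f s t' - f s' t + f s t by ring]

lemma Reg.line {a1 a2 K : ℝ} {f : ℝ → ℝ → ℝ} (h : Reg a1 a2 K f) {s : ℝ} (hs : s ∈ I01) :
    Bd K (f s) ∧ Hol_s10 a2 K (f s) :=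
  ⟨fun x h0 h1 => h.bd s hs x ⟨h0, h1⟩,
    fun x y h0 hxy h1 => h.h2 s hs x ⟨h0, by linarith⟩ y ⟨by linarith, h1⟩ hxy⟩

lemma Reg.incr {a1 a2 K : ℝ} {f : ℝ → ℝ → ℝ} (h : Reg a1 a2 K f) {s s' : ℝ} (hs : s ∈ I01)
    (hs' : s' ∈ I01) (hle : s ≤ s') :
    Bd (K * (s' - s) ^ a1) (fun t => f s' t - f s t) ∧
      Hol_s10 a2 (K * (s' - s) ^ a1) (fun t => f s' t - f s t) :=
  ⟨fun x h0 h1 => h.h1 s hs s' hs' x ⟨h0, h1⟩ hle,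
    fun x y h0 hxy h1 => h.hr s hs s' hs' x ⟨h0, by linarith⟩ y ⟨by linarith, h1⟩ hle hxy⟩

/-- The (second type) Riemann sum. -/
def RS (f g h : ℝ → ℝ → ℝ) (m m' : ℕ) (σ τ : ℕ → ℝ) : ℝ :=
  ∑ i ∈ Finset.range m, ∑ j ∈ Finset.range m',
    f (σ i) (τ j) * (g (σ (i + 1)) (τ j) - g (σ i) (τ j)) * (h (σ i) (τ (j + 1)) - h (σ i) (τ j))

/-- The sum of powers of mesh sizes. -/
def VS (θ : ℝ) (m : ℕ) (σ : ℕ → ℝ) : ℝ := ∑ i ∈ Finset.range m, (σ (i + 1) - σ i) ^ θ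

lemma dir1 {γ1 γ2 ρ1 ρ2 β1 β2 F G H : ℝ} {f g h : ℝ → ℝ → ℝ}
    (hγ1 : 0 < γ1) (hγ2 : 0 < γ2) (hρ1 : 0 < ρ1) (hρ2 : 0 < ρ2) (hβ1 : 0 < β1) (hβ2 : 0 < β2)
    (hγρ1 : 1 < γ1 + ρ1) (hβρ1 : 1 < β1 + ρ1) (hβγ2 : 1 < β2 + γ2) (hβρ2 : 1 < β2 + ρ2)
    (hf : Reg γ1 γ2 F f) (hg : Reg ρ1 ρ2 G g) (hh : Reg β1 β2 H h) :
    ∃ C θ : ℝ, 1 < θ ∧ ∀ (n n' k : ℕ) (σ σ' τ : ℕ → ℝ), (∀ i < n, σ i ≤ σ (i + 1)) →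
      (∀ i < n', σ' i ≤ σ' (i + 1)) → (∀ i < k, τ i ≤ τ (i + 1)) →
      0 ≤ σ 0 → σ n ≤ 1 → σ 0 = σ' 0 → σ n = σ' n' → 0 ≤ τ 0 → τ k ≤ 1 →
      |RS f g h n k σ τ - RS f g h n' k σ' τ| ≤ C * (VS θ n σ + VS θ n' σ') := by
  set e := min γ1 β1 with he
  have he0 : 0 < e := lt_min hγ1 hβ1
  have hθ : 1 < e + ρ1 := by rw [he, ← min_add_add_right]; exact lt_min hγρ1 hβρ1
  obtain ⟨C, hC, hyoung⟩ := young γ2 ρ2 β2 hγ2 hρ2 hβ2 (by linarith) (by linarith)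
  obtain ⟨C', hC', hcmp⟩ := refine_cmp (e + ρ1) hθ
  have F0 := hf.nn
  have G0 := hg.nn
  have H0 := hh.nn
  refine ⟨C' * (2 * C * (F * G * H)), e + ρ1, hθ, ?_⟩
  intro n n' k σ σ' τ hσ hσ' hτ h0 h1 hee hee' t0 t1
  refine hcmp (fun s u => ∑ j ∈ Finset.range k,
    f s (τ j) * (g u (τ j) - g s (τ j)) * (h s (τ (j + 1)) - h s (τ j)))
    (2 * C * (F * G * H)) (by positivity) ?_ n n' σ σ' hσ hσ' h0 h1 hee hee'
  intro s v u hs hsv hvu hu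
  have ms : s ∈ I01 := ⟨hs, by linarith⟩
  have mv : v ∈ I01 := ⟨by linarith, by linarith⟩
  have mu : u ∈ I01 := ⟨by linarith, hu⟩
  have q1 : 0 ≤ (v - s) ^ γ1 := Real.rpow_nonneg (by linarith) _
  have q2 : 0 ≤ (u - v) ^ ρ1 := Real.rpow_nonneg (by linarith) _
  have q3 : 0 ≤ (v - s) ^ β1 := Real.rpow_nonneg (by linarith) _
  have df := hf.incr ms mv hsv
  have dg := hg.incr mv mu hvu
  have dh := hh.incr ms mv hsv
  have y1 := hyoung _ _ _ _ _ _ (by positivity) (by positivity) H0 df.1 df.2 dg.1 dg.2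
    (hh.line ms).2 k τ hτ t0 t1
  have y2 := hyoung _ _ _ _ _ _ F0 (by positivity) (by positivity) (hf.line mv).1 (hf.line mv).2
    dg.1 dg.2 dh.2 k τ hτ t0 t1
  have hid : (∑ j ∈ Finset.range k, f s (τ j) * (g u (τ j) - g s (τ j)) * (h s (τ (j + 1)) - h s (τ j)))
      - (∑ j ∈ Finset.range k, f s (τ j) * (g v (τ j) - g s (τ j)) * (h s (τ (j + 1)) - h s (τ j)))
      - (∑ j ∈ Finset.range k, f v (τ j) * (g u (τ j) - g v (τ j)) * (h v (τ (j + 1)) - h v (τ j)))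
      = - ((∑ j ∈ Finset.range k, (f v (τ j) - f s (τ j)) * (g u (τ j) - g v (τ j)) *
            (h s (τ (j + 1)) - h s (τ j)))
        + ∑ j ∈ Finset.range k, f v (τ j) * (g u (τ j) - g v (τ j)) *
          ((h v (τ (j + 1)) - h s (τ (j + 1))) - (h v (τ j) - h s (τ j)))) := by
    rw [← Finset.sum_sub_distrib, ← Finset.sum_sub_distrib, ← Finset.sum_add_distrib,
      ← Finset.sum_neg_distrib]
    exact Finset.sum_congr rfl fun j _ => by ring
  rw [hid, abs_neg]
  refine (abs_add_le _ _).trans ((add_le_add y1 y2).trans ?_)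
  have r1 : (v - s) ^ γ1 ≤ (v - s) ^ e :=
    rpow_le_of_exp (by linarith) (by linarith) he0 (min_le_left _ _)
  have r2 : (v - s) ^ β1 ≤ (v - s) ^ e :=
    rpow_le_of_exp (by linarith) (by linarith) he0 (min_le_right _ _)
  have r3 := rpow_split_le he0 hρ1 hsv hvu
  have r4 := (mul_le_mul_of_nonneg_right r1 q2).trans r3
  have r5 := (mul_le_mul_of_nonneg_right r2 q2).trans r3
  have hcf : 0 ≤ C * (F * G * H) := by positivity
  have r6 := mul_le_mul_of_nonneg_left r4 hcf
  have r7 := mul_le_mul_of_nonneg_left r5 hcf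
  linarith

lemma RS_swap (f g h : ℝ → ℝ → ℝ) (m m' : ℕ) (σ τ : ℕ → ℝ) :
    RS f g h m m' σ τ =
      RS (fun t s => f s t) (fun t s => h s t) (fun t s => g s t) m' m τ σ := by
  unfold RS
  rw [Finset.sum_comm]
  exact Finset.sum_congr rfl fun j _ => Finset.sum_congr rfl fun i _ => by ring

lemma VS_tendsto {θ a b : ℝ} (hθ : 1 < θ) (ha : 0 ≤ a) (hb : b ≤ 1) {m : ℕ → ℕ} {σ : ℕ → ℕ → ℝ}
    (h : IsPartSeq a b m σ) : Tendsto (fun n => VS θ (m n) (σ n)) atTop (𝓝 0) := by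
  obtain ⟨p0, p1, p2, p3⟩ := h
  rw [Metric.tendsto_atTop]
  intro ε hε
  have hδ : 0 < (ε / 2) ^ (1 / (θ - 1)) := by positivity
  obtain ⟨N, hN⟩ := p3 _ hδ
  refine ⟨N, fun n hn => ?_⟩
  have hnn : 0 ≤ VS θ (m n) (σ n) := Finset.sum_nonneg fun i hi =>
    Real.rpow_nonneg (by linarith [p2 n i (Finset.mem_range.1 hi)]) _
  rw [Real.dist_eq, sub_zero, abs_of_nonneg hnn]
  have : VS θ (m n) (σ n) ≤ ε / 2 * ∑ i ∈ Finset.range (m n), (σ n (i + 1) - σ n i) := by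
    rw [Finset.mul_sum]
    refine Finset.sum_le_sum fun i hi => ?_
    have x1 := p2 n i (Finset.mem_range.1 hi)
    have x2 := hN n hn i (Finset.mem_range.1 hi)
    have x0 : 0 < σ n (i + 1) - σ n i := by linarith
    have e1 : (σ n (i + 1) - σ n i) ^ θ = (σ n (i + 1) - σ n i) ^ (θ - 1) * (σ n (i + 1) - σ n i) := by
      conv_lhs => rw [show θ = (θ - 1) + 1 by ring, Real.rpow_add x0, Real.rpow_one]
    rw [e1]
    refine mul_le_mul_of_nonneg_right ?_ x0.le
    calc _ ≤ ((ε / 2) ^ (1 / (θ - 1))) ^ (θ - 1) := Real.rpow_le_rpow x0.le x2.le (by linarith)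
      _ = ε / 2 := by
        rw [← Real.rpow_mul (by positivity), one_div, inv_mul_cancel₀ (by linarith), Real.rpow_one]
  rw [Finset.sum_range_sub, p0, p1] at this
  nlinarith

lemma diff_bound {γ1 γ2 ρ1 ρ2 β1 β2 F G H : ℝ} {f g h : ℝ → ℝ → ℝ}
    (hγ2 : 0 < γ2) (hρ1 : 0 < ρ1) (hρ2 : 0 < ρ2) (hβ1 : 0 < β1) (hβ2 : 0 < β2)
    (hβγ2 : 1 < β2 + γ2) (hβρ2 : 1 < β2 + ρ2)
    (hf : Reg γ1 γ2 F f) (hg : Reg ρ1 ρ2 G g) (hh : Reg β1 β2 H h) :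
    ∃ C : ℝ, ∀ (n k : ℕ) (σ τ : ℕ → ℝ), (∀ i < n, σ i ≤ σ (i + 1)) →
      (∀ i < k, τ i ≤ τ (i + 1)) → 0 ≤ σ 0 → σ n ≤ 1 → 0 ≤ τ 0 → τ k ≤ 1 →
      |(∑ i ∈ Finset.range n, ∑ j ∈ Finset.range k,
          f (σ i) (τ j) * (g (σ (i + 1)) (τ j) - g (σ i) (τ j)) *
            (h (σ (i + 1)) (τ (j + 1)) - h (σ (i + 1)) (τ j))) - RS f g h n k σ τ|
        ≤ C * VS (β1 + ρ1) n σ := by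
  obtain ⟨C, hC, hyoung⟩ := young γ2 ρ2 β2 hγ2 hρ2 hβ2 (by linarith) (by linarith)
  have F0 := hf.nn
  have G0 := hg.nn
  have H0 := hh.nn
  refine ⟨C * (F * G * H), ?_⟩
  intro n k σ τ hσ hτ h0 h1 t0 t1
  unfold RS VS
  rw [← Finset.sum_sub_distrib, Finset.mul_sum]
  refine (Finset.abs_sum_le_sum_abs _ _).trans (Finset.sum_le_sum fun i hi => ?_)
  have hi := Finset.mem_range.1 hi
  have p1 : σ 0 ≤ σ i := pt_mono hσ (Nat.zero_le _) hi.le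
  have p2 : σ (i + 1) ≤ σ n := pt_mono hσ hi le_rfl
  have p3 := hσ i hi
  have m1 : σ i ∈ I01 := ⟨by linarith, by linarith⟩
  have m2 : σ (i + 1) ∈ I01 := ⟨by linarith, by linarith⟩
  have q1 : 0 ≤ (σ (i + 1) - σ i) ^ ρ1 := Real.rpow_nonneg (by linarith) _
  have q2 : 0 ≤ (σ (i + 1) - σ i) ^ β1 := Real.rpow_nonneg (by linarith) _
  have dg := hg.incr m1 m2 p3
  have dh := hh.incr m1 m2 p3
  have y := hyoung _ _ _ _ _ _ F0 (by positivity) (by positivity) (hf.line m1).1 (hf.line m1).2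
    dg.1 dg.2 dh.2 k τ hτ t0 t1
  rw [← Finset.sum_sub_distrib]
  rw [Real.rpow_add_of_nonneg (by linarith) hβ1.le hρ1.le]
  calc _ = _ := by
        congr 1
        refine Finset.sum_congr rfl fun j _ => ?_
        rw [← mul_sub, sub_sub_sub_comm]
    _ ≤ _ := y
    _ = _ := by ring

theorem mixed_planar_young_three_drivers
    (γ1 γ2 ρ1 ρ2 β1 β2 : ℝ)
    (hγ1 : γ1 ∈ Set.Ioo (0:ℝ) 1) (hγ2 : γ2 ∈ Set.Ioo (0:ℝ) 1)
    (hρ1 : ρ1 ∈ Set.Ioo (0:ℝ) 1) (hρ2 : ρ2 ∈ Set.Ioo (0:ℝ) 1)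
    (hβ1 : β1 ∈ Set.Ioo (0:ℝ) 1) (hβ2 : β2 ∈ Set.Ioo (0:ℝ) 1)
    (hγρ1 : 1 < γ1 + ρ1) (hγρ2 : 1 < γ2 + ρ2)
    (hβγ1 : 1 < β1 + γ1) (hβγ2 : 1 < β2 + γ2)
    (hβρ1 : 1 < β1 + ρ1) (hβρ2 : 1 < β2 + ρ2)
    (f g h : ℝ → ℝ → ℝ)
    (hfc : ContinuousOn (fun p : ℝ × ℝ => f p.1 p.2) (I01 ×ˢ I01))
    (hgc : ContinuousOn (fun p : ℝ × ℝ => g p.1 p.2) (I01 ×ˢ I01))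
    (hhc : ContinuousOn (fun p : ℝ × ℝ => h p.1 p.2) (I01 ×ˢ I01))
    (hfN : NN γ1 γ2 f ≠ ⊤) (hgN : NN ρ1 ρ2 g ≠ ⊤) (hhN : NN β1 β2 h ≠ ⊤) :
    ∃ L : ℝ → ℝ → ℝ → ℝ → ℝ,
      ∀ s1 ∈ I01, ∀ s2 ∈ I01, ∀ t1 ∈ I01, ∀ t2 ∈ I01, s1 ≤ s2 → t1 ≤ t2 →
        ∀ (m m' : ℕ → ℕ) (σ τ : ℕ → ℕ → ℝ),
          IsPartSeq s1 s2 m σ → IsPartSeq t1 t2 m' τ →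
          Tendsto (fun n => ∑ i ∈ Finset.range (m n), ∑ j ∈ Finset.range (m' n),
              f (σ n i) (τ n j) * d1 g (σ n i) (σ n (i + 1)) (τ n j) *
                d2 h (σ n (i + 1)) (τ n j) (τ n (j + 1)))
            atTop (𝓝 (L s1 s2 t1 t2)) ∧
          Tendsto (fun n => ∑ i ∈ Finset.range (m n), ∑ j ∈ Finset.range (m' n),
              f (σ n i) (τ n j) * d1 g (σ n i) (σ n (i + 1)) (τ n j) *
                d2 h (σ n i) (τ n j) (τ n (j + 1)))
            atTop (𝓝 (L s1 s2 t1 t2)) := by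
  obtain ⟨F, hf⟩ := reg_of_NN f hγ1.1 hγ2.1 hfN
  obtain ⟨G, hg⟩ := reg_of_NN g hρ1.1 hρ2.1 hgN
  obtain ⟨H, hh⟩ := reg_of_NN h hβ1.1 hβ2.1 hhN
  obtain ⟨C1, θ1, hθ1, D1⟩ := dir1 hγ1.1 hγ2.1 hρ1.1 hρ2.1 hβ1.1 hβ2.1 hγρ1 hβρ1 hβγ2 hβρ2 hf hg hh
  obtain ⟨C2, θ2, hθ2, D2⟩ := dir1 hγ2.1 hγ1.1 hβ2.1 hβ1.1 hρ2.1 hρ1.1 (by linarith) (by linarith)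
    (by linarith) (by linarith) hf.swap hh.swap hg.swap
  obtain ⟨C3, D3⟩ := diff_bound hγ2.1 hρ1.1 hρ2.1 hβ1.1 hβ2.1 hβγ2 hβρ2 hf hg hh
  -- it suffices to find the limit for each rectangle
  suffices hmain : ∀ s1 s2 t1 t2 : ℝ, ∃ ℓ : ℝ, s1 ∈ I01 → s2 ∈ I01 → t1 ∈ I01 → t2 ∈ I01 →
      ∀ (m m' : ℕ → ℕ) (σ τ : ℕ → ℕ → ℝ), IsPartSeq s1 s2 m σ → IsPartSeq t1 t2 m' τ →
        Tendsto (fun n => RS f g h (m n) (m' n) (σ n) (τ n)) atTop (𝓝 ℓ) by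
    choose L hL using hmain
    refine ⟨L, ?_⟩
    intro s1 hs1 s2 hs2 t1 ht1 t2 ht2 _ _ m m' σ τ hσ hτ
    have T := hL s1 s2 t1 t2 hs1 hs2 ht1 ht2 m m' σ τ hσ hτ
    refine ⟨?_, T⟩
    have V := VS_tendsto (θ := β1 + ρ1) hβρ1 hs1.1 hs2.2 hσ
    have V' := V.const_mul C3
    rw [mul_zero] at V'
    have W := squeeze_zero_norm (fun n => by
      rw [Real.norm_eq_abs]
      exact D3 (m n) (m' n) (σ n) (τ n) (fun i hi => (hσ.2.2.1 n i hi).le)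
        (fun i hi => (hτ.2.2.1 n i hi).le) (by rw [hσ.1]; exact hs1.1) (by rw [hσ.2.1]; exact hs2.2)
        (by rw [hτ.1]; exact ht1.1) (by rw [hτ.2.1]; exact ht2.2)) V'
    have := W.add T
    rw [zero_add] at this
    refine this.congr fun n => ?_
    rw [sub_add_cancel]
    rfl
  intro s1 s2 t1 t2
  by_cases hex : s1 ∈ I01 ∧ s2 ∈ I01 ∧ t1 ∈ I01 ∧ t2 ∈ I01 ∧
      ∃ (m m' : ℕ → ℕ) (σ τ : ℕ → ℕ → ℝ), IsPartSeq s1 s2 m σ ∧ IsPartSeq t1 t2 m' τ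
  swap
  · exact ⟨0, fun h1 h2 h3 h4 m m' σ τ hσ hτ =>
      absurd ⟨h1, h2, h3, h4, m, m', σ, τ, hσ, hτ⟩ hex⟩
  obtain ⟨hs1, hs2, ht1, ht2, m0, m0', σ0, τ0, hσ0, hτ0⟩ := hex
  have cmp : ∀ (m m' : ℕ → ℕ) (σ τ : ℕ → ℕ → ℝ), IsPartSeq s1 s2 m σ → IsPartSeq t1 t2 m' τ →
      ∀ n n0, |RS f g h (m n) (m' n) (σ n) (τ n) - RS f g h (m0 n0) (m0' n0) (σ0 n0) (τ0 n0)| ≤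
        (C1 * VS θ1 (m n) (σ n) + C2 * VS θ2 (m' n) (τ n)) +
        (C1 * VS θ1 (m0 n0) (σ0 n0) + C2 * VS θ2 (m0' n0) (τ0 n0)) := by
    intro m m' σ τ hσ hτ n n0
    have a1 := D1 (m n) (m0 n0) (m' n) (σ n) (σ0 n0) (τ n) (fun i hi => (hσ.2.2.1 n i hi).le)
      (fun i hi => (hσ0.2.2.1 n0 i hi).le) (fun i hi => (hτ.2.2.1 n i hi).le)
      (by rw [hσ.1]; exact hs1.1) (by rw [hσ.2.1]; exact hs2.2) (by rw [hσ.1, hσ0.1])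
      (by rw [hσ.2.1, hσ0.2.1]) (by rw [hτ.1]; exact ht1.1) (by rw [hτ.2.1]; exact ht2.2)
    have a2 := D2 (m' n) (m0' n0) (m0 n0) (τ n) (τ0 n0) (σ0 n0) (fun i hi => (hτ.2.2.1 n i hi).le)
      (fun i hi => (hτ0.2.2.1 n0 i hi).le) (fun i hi => (hσ0.2.2.1 n0 i hi).le)
      (by rw [hτ.1]; exact ht1.1) (by rw [hτ.2.1]; exact ht2.2) (by rw [hτ.1, hτ0.1])
      (by rw [hτ.2.1, hτ0.2.1]) (by rw [hσ0.1]; exact hs1.1) (by rw [hσ0.2.1]; exact hs2.2)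
    rw [← RS_swap f g h (m0 n0) (m' n) (σ0 n0) (τ n),
      ← RS_swap f g h (m0 n0) (m0' n0) (σ0 n0) (τ0 n0)] at a2
    have := (abs_sub_le _ _ _).trans (add_le_add a1 a2)
    linarith
  have vt : ∀ (m m' : ℕ → ℕ) (σ τ : ℕ → ℕ → ℝ), IsPartSeq s1 s2 m σ → IsPartSeq t1 t2 m' τ →
      Tendsto (fun n => C1 * VS θ1 (m n) (σ n) + C2 * VS θ2 (m' n) (τ n)) atTop (𝓝 0) := by
    intro m m' σ τ hσ hτ
    have := ((VS_tendsto hθ1 hs1.1 hs2.2 hσ).const_mul C1).add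
      ((VS_tendsto hθ2 ht1.1 ht2.2 hτ).const_mul C2)
    simpa using this
  have v0 := vt m0 m0' σ0 τ0 hσ0 hτ0
  have hcau : CauchySeq (fun n => RS f g h (m0 n) (m0' n) (σ0 n) (τ0 n)) := by
    rw [Metric.cauchySeq_iff]
    intro ε hε
    obtain ⟨N, hN⟩ := eventually_atTop.1 (v0.eventually (gt_mem_nhds (half_pos hε)))
    refine ⟨N, fun a ha b hb => ?_⟩
    rw [Real.dist_eq]
    have := cmp m0 m0' σ0 τ0 hσ0 hτ0 a b
    linarith [hN a ha, hN b hb]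
  obtain ⟨ℓ, hℓ⟩ := cauchySeq_tendsto_of_complete hcau
  refine ⟨ℓ, fun _ _ _ _ m m' σ τ hσ hτ => ?_⟩
  have v1 := (vt m m' σ τ hσ hτ).add v0
  rw [add_zero] at v1
  have W := squeeze_zero_norm (fun n => by
    rw [Real.norm_eq_abs]
    exact cmp m m' σ τ hσ hτ n n) v1
  have := W.add hℓ
  rw [zero_add] at this
  exact this.congr fun n => by rw [sub_add_cancel]
end
end

section
/- (Hölder norms under composition.) Let θ_1, θ_2 ∈ (0,1), let x : [0,1]^2 → ℝ be continuous with N_{θ_1,θ_2}(x) < ∞, let f ∈ C^2(ℝ,ℝ) and set y = f∘x. Then ||y||_{θ_1,1} ≤ (sup_{(s,t)∈[0,1]^2} |f'(x(s,t))|) ||x||_{θ_1,1} and ||y||_{θ_2,2} ≤ (sup |f'(x(s,t))|) ||x||_{θ_2,2}; moreover there is a universal constant C such that ||y||_{θ_1,θ_2} ≤ C (sup |f'(x(s,t))| + sup |f''(x(s,t))|) N_{θ_1,θ_2}(x)(1 + N_{θ_1,θ_2}(x)). -/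
open Set Filter
open scoped ENNReal Topology

noncomputable section

lemma aux_lip {J : Set ℝ} (hJ : Convex ℝ J) {f : ℝ → ℝ} (hf : Differentiable ℝ f) {A : ℝ}
    (hA : ∀ u ∈ J, |deriv f u| ≤ A) {u v : ℝ} (hu : u ∈ J) (hv : v ∈ J) :
    |f v - f u| ≤ A * |v - u| := by
  have := hJ.norm_image_sub_le_of_norm_deriv_le (f := f) (C := A)
    (fun x _ => hf x) (fun x hx => by simpa using hA x hx) hu hv
  simpa using this

lemma aux_rect {J : Set ℝ} (hJ : Convex ℝ J) {f : ℝ → ℝ} (hf : Differentiable ℝ f)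
    (hf' : Differentiable ℝ (deriv f)) {A B M : ℝ}
    (hA : ∀ u ∈ J, |deriv f u| ≤ A) (hB : ∀ u ∈ J, |deriv (deriv f) u| ≤ B)
    {a b c d : ℝ} (ha : a ∈ J) (hb : b ∈ J) (hc : c ∈ J) (hd : d ∈ J)
    (h1 : |c - a| ≤ M) (h2 : |d - b| ≤ M) :
    |f d - f c - f b + f a| ≤ A * |d - c - b + a| + B * M * |b - a| := by
  have hder : ∀ p q l : ℝ, HasDerivAt (fun l : ℝ => f (p + l * (q - p)))
      (deriv f (p + l * (q - p)) * (q - p)) l := by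
    intro p q l
    have e : HasDerivAt (fun l : ℝ => p + l * (q - p)) (q - p) l := by
      simpa using ((hasDerivAt_id l).mul_const (q - p)).const_add p
    exact (hf (p + l * (q - p))).hasDerivAt.comp l e
  have mem : ∀ p q l : ℝ, p ∈ J → q ∈ J → l ∈ Set.Icc (0:ℝ) 1 → p + l * (q - p) ∈ J := by
    intro p q l hp hq hl
    have := hJ hp hq (sub_nonneg.2 hl.2) hl.1 (by ring)
    convert this using 1
    simp only [smul_eq_mul]; ring
  have hB0 : 0 ≤ B := (abs_nonneg _).trans (hB a ha)
  have key := (convex_Icc (0:ℝ) 1).norm_image_sub_le_of_norm_hasDerivWithin_le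
    (f := fun l : ℝ => f (c + l * (d - c)) - f (a + l * (b - a)))
    (f' := fun l : ℝ => deriv f (c + l * (d - c)) * (d - c) - deriv f (a + l * (b - a)) * (b - a))
    (C := A * |d - c - b + a| + B * M * |b - a|)
    (fun l _ => ((hder c d l).sub (hder a b l)).hasDerivWithinAt)
    (fun l hl => by
      have m1 := mem c d l hc hd hl
      have m2 := mem a b l ha hb hl
      have e1 := hA _ m1
      have e2 := aux_lip hJ hf' hB m2 m1
      have e3 : |c + l * (d - c) - (a + l * (b - a))| ≤ M := by
        have : c + l * (d - c) - (a + l * (b - a)) = (1 - l) * (c - a) + l * (d - b) := by ring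
        rw [this]
        obtain ⟨l0, l1⟩ := hl
        rw [abs_le] at h1 h2 ⊢
        constructor <;> nlinarith
      have e4 : deriv f (c + l * (d - c)) * (d - c) - deriv f (a + l * (b - a)) * (b - a)
          = deriv f (c + l * (d - c)) * (d - c - b + a)
            + (deriv f (c + l * (d - c)) - deriv f (a + l * (b - a))) * (b - a) := by ring
      rw [Real.norm_eq_abs, e4]
      refine (abs_add_le _ _).trans ?_
      rw [abs_mul, abs_mul]
      gcongr
      exact e2.trans (by gcongr))
    (Set.left_mem_Icc.2 zero_le_one) (Set.right_mem_Icc.2 zero_le_one)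
  have e : f d - f c - f b + f a = f d - f b - (f c - f a) := by ring
  rw [e]
  simpa using key

lemma aux_div {a b H : ℝ} (hH : 0 ≤ H) (hb : 0 ≤ b) (h : a ≤ H * b) : a / b ≤ H :=
  div_le_of_le_mul₀ hb hH h

lemma aux_undiv {a b : ℝ} {H : ℝ≥0∞} (hH : H ≠ ⊤) (hb : 0 ≤ b) (h0 : b = 0 → a = 0)
    (h : ENNReal.ofReal (a / b) ≤ H) : a ≤ H.toReal * b := by
  have h' := (ENNReal.ofReal_le_iff_le_toReal hH).1 h
  rcases hb.eq_or_lt with e | e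
  · rw [h0 e.symm, ← e]; simp
  · exact (div_le_iff₀ e).1 h'

lemma aux_sup {x : ℝ → ℝ → ℝ}
    (hx : ContinuousOn (fun p : ℝ × ℝ => x p.1 p.2) (I01 ×ˢ I01)) {g : ℝ → ℝ}
    (hg : Continuous g) :
    (⨆ (s : I01) (t : I01), ENNReal.ofReal |g (x (s : ℝ) (t : ℝ))|) ≠ ⊤ := by
  have hc : IsCompact (I01 ×ˢ I01) := (isCompact_Icc (a := (0:ℝ)) (b := 1)).prod isCompact_Icc
  obtain ⟨K, hK⟩ := hc.exists_bound_of_continuousOn (hg.comp_continuousOn hx)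
  refine ne_top_of_le_ne_top (ENNReal.ofReal_ne_top (r := K)) ?_
  refine iSup_le fun s => iSup_le fun t => ENNReal.ofReal_le_ofReal ?_
  exact hK ((s : ℝ), (t : ℝ)) ⟨s.2, t.2⟩

theorem holder_norms_under_composition :
    ∃ C : ℝ, ∀ (θ1 θ2 : ℝ), θ1 ∈ Set.Ioo (0:ℝ) 1 → θ2 ∈ Set.Ioo (0:ℝ) 1 →
      ∀ x : ℝ → ℝ → ℝ,
        ContinuousOn (fun p : ℝ × ℝ => x p.1 p.2) (I01 ×ˢ I01) →
        NN θ1 θ2 x ≠ ⊤ →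
        ∀ f : ℝ → ℝ, ContDiff ℝ 2 f →
          hol1 θ1 (fun s t => f (x s t)) ≤
            (⨆ (s : I01) (t : I01), ENNReal.ofReal |deriv f (x (s : ℝ) (t : ℝ))|) *
              hol1 θ1 x ∧
          hol2 θ2 (fun s t => f (x s t)) ≤
            (⨆ (s : I01) (t : I01), ENNReal.ofReal |deriv f (x (s : ℝ) (t : ℝ))|) *
              hol2 θ2 x ∧
          holRect θ1 θ2 (fun s t => f (x s t)) ≤
            ENNReal.ofReal C *
              ((⨆ (s : I01) (t : I01), ENNReal.ofReal |deriv f (x (s : ℝ) (t : ℝ))|) +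
                (⨆ (s : I01) (t : I01),
                  ENNReal.ofReal |deriv (deriv f) (x (s : ℝ) (t : ℝ))|)) *
              NN θ1 θ2 x * (1 + NN θ1 θ2 x) := by
  refine ⟨1, ?_⟩
  intro θ1 θ2 hθ1 hθ2 x hx hN f hf
  have hfd : Differentiable ℝ f := hf.differentiable (by norm_num)
  have hf1 : ContDiff ℝ 1 (deriv f) :=
    ((contDiff_succ_iff_deriv (n := 1)).1 (by simpa [one_add_one_eq_two] using hf)).2.2
  have hfd' : Differentiable ℝ (deriv f) := hf1.differentiable (by norm_num)
  have hfc' : Continuous (deriv (deriv f)) := hf1.continuous_deriv (by norm_num)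
  have hAt := aux_sup hx hf1.continuous
  have hBt := aux_sup hx hfc'
  have hAle : ∀ s ∈ I01, ∀ t ∈ I01, ENNReal.ofReal |deriv f (x s t)| ≤
      ⨆ (s : I01) (t : I01), ENNReal.ofReal |deriv f (x (s : ℝ) (t : ℝ))| := fun s hs t ht =>
    le_iSup₂ (f := fun (s : I01) (t : I01) => ENNReal.ofReal |deriv f (x (s : ℝ) (t : ℝ))|)
      ⟨s, hs⟩ ⟨t, ht⟩
  have hBle : ∀ s ∈ I01, ∀ t ∈ I01, ENNReal.ofReal |deriv (deriv f) (x s t)| ≤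
      ⨆ (s : I01) (t : I01), ENNReal.ofReal |deriv (deriv f) (x (s : ℝ) (t : ℝ))| :=
    fun s hs t ht =>
    le_iSup₂ (f := fun (s : I01) (t : I01) =>
      ENNReal.ofReal |deriv (deriv f) (x (s : ℝ) (t : ℝ))|) ⟨s, hs⟩ ⟨t, ht⟩
  generalize (⨆ (s : I01) (t : I01), ENNReal.ofReal |deriv f (x (s : ℝ) (t : ℝ))|) = A at *
  generalize (⨆ (s : I01) (t : I01),
    ENNReal.ofReal |deriv (deriv f) (x (s : ℝ) (t : ℝ))|) = B at *
  set J : Set ℝ := (fun p : ℝ × ℝ => x p.1 p.2) '' (I01 ×ˢ I01) with hJdef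
  have hJ : Convex ℝ J := by
    have : IsPreconnected (I01 ×ˢ I01) :=
      (isPreconnected_Icc (a := (0:ℝ)) (b := 1)).prod isPreconnected_Icc
    exact (this.image _ hx).ordConnected.convex
  have hmem : ∀ s t : I01, x s t ∈ J := fun s t => ⟨((s : ℝ), (t : ℝ)), ⟨s.2, t.2⟩, rfl⟩
  have hA : ∀ u ∈ J, |deriv f u| ≤ A.toReal := by
    rintro _ ⟨p, hp, rfl⟩
    exact (ENNReal.ofReal_le_iff_le_toReal hAt).1 (hAle _ hp.1 _ hp.2)
  have hB : ∀ u ∈ J, |deriv (deriv f) u| ≤ B.toReal := by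
    rintro _ ⟨p, hp, rfl⟩
    exact (ENNReal.ofReal_le_iff_le_toReal hBt).1 (hBle _ hp.1 _ hp.2)
  have hRN : holRect θ1 θ2 x ≤ NN θ1 θ2 x := by
    unfold NN; rw [add_assoc, add_assoc]; exact le_self_add
  have h1N : hol1 θ1 x ≤ NN θ1 θ2 x := by
    unfold NN; rw [add_assoc, add_right_comm]; exact le_add_self
  have h2N : hol2 θ2 x ≤ NN θ1 θ2 x := by
    unfold NN; rw [add_right_comm]; exact le_add_self
  have hRt := ne_top_of_le_ne_top hN hRN
  have h1t := ne_top_of_le_ne_top hN h1N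
  have h2t := ne_top_of_le_ne_top hN h2N
  have b1 : ∀ s1 s2 t : I01, |x s2 t - x s1 t| ≤
      (hol1 θ1 x).toReal * |(s2 : ℝ) - (s1 : ℝ)| ^ θ1 := by
    intro s1 s2 t
    refine aux_undiv h1t (by positivity) ?_ ?_
    · intro h
      rw [Real.rpow_eq_zero (abs_nonneg _) hθ1.1.ne', abs_eq_zero, sub_eq_zero] at h
      simp [h]
    · unfold hol1
      exact le_iSup_of_le s1 (le_iSup_of_le s2 (le_iSup_of_le t le_rfl))
  have b2 : ∀ s t1 t2 : I01, |x s t2 - x s t1| ≤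
      (hol2 θ2 x).toReal * |(t2 : ℝ) - (t1 : ℝ)| ^ θ2 := by
    intro s t1 t2
    refine aux_undiv h2t (by positivity) ?_ ?_
    · intro h
      rw [Real.rpow_eq_zero (abs_nonneg _) hθ2.1.ne', abs_eq_zero, sub_eq_zero] at h
      simp [h]
    · unfold hol2
      exact le_iSup_of_le s (le_iSup_of_le t1 (le_iSup_of_le t2 le_rfl))
  have bR : ∀ s1 s2 t1 t2 : I01, |x s2 t2 - x s1 t2 - x s2 t1 + x s1 t1| ≤
      (holRect θ1 θ2 x).toReal * (|(s2 : ℝ) - (s1 : ℝ)| ^ θ1 * |(t2 : ℝ) - (t1 : ℝ)| ^ θ2) := by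
    intro s1 s2 t1 t2
    refine aux_undiv hRt (by positivity) ?_ ?_
    · intro h
      rcases mul_eq_zero.1 h with h | h
      · rw [Real.rpow_eq_zero (abs_nonneg _) hθ1.1.ne', abs_eq_zero, sub_eq_zero] at h
        simp [h]
      · rw [Real.rpow_eq_zero (abs_nonneg _) hθ2.1.ne', abs_eq_zero, sub_eq_zero] at h
        simp [h]
    · unfold holRect
      exact le_iSup_of_le s1 (le_iSup_of_le s2 (le_iSup_of_le t1 (le_iSup_of_le t2 le_rfl)))
  refine ⟨?_, ?_, ?_⟩
  · rw [hol1]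
    refine iSup_le fun s1 => iSup_le fun s2 => iSup_le fun t => ?_
    rw [ENNReal.ofReal_le_iff_le_toReal (ENNReal.mul_ne_top hAt h1t), ENNReal.toReal_mul]
    refine aux_div (by positivity) (by positivity) ?_
    refine (aux_lip hJ hfd hA (hmem s1 t) (hmem s2 t)).trans ?_
    rw [mul_assoc]
    exact mul_le_mul_of_nonneg_left (b1 s1 s2 t) ENNReal.toReal_nonneg
  · rw [hol2]
    refine iSup_le fun s => iSup_le fun t1 => iSup_le fun t2 => ?_
    rw [ENNReal.ofReal_le_iff_le_toReal (ENNReal.mul_ne_top hAt h2t), ENNReal.toReal_mul]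
    refine aux_div (by positivity) (by positivity) ?_
    refine (aux_lip hJ hfd hA (hmem s t1) (hmem s t2)).trans ?_
    rw [mul_assoc]
    exact mul_le_mul_of_nonneg_left (b2 s t1 t2) ENNReal.toReal_nonneg
  · have main : holRect θ1 θ2 (fun s t => f (x s t)) ≤
        A * holRect θ1 θ2 x + B * hol2 θ2 x * hol1 θ1 x := by
      rw [holRect]
      refine iSup_le fun s1 => iSup_le fun s2 => iSup_le fun t1 => iSup_le fun t2 => ?_
      have n1 := ENNReal.mul_ne_top hAt hRt
      have n2 := ENNReal.mul_ne_top (ENNReal.mul_ne_top hBt h2t) h1t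
      rw [ENNReal.ofReal_le_iff_le_toReal (ENNReal.add_ne_top.2 ⟨n1, n2⟩),
        ENNReal.toReal_add n1 n2, ENNReal.toReal_mul, ENNReal.toReal_mul, ENNReal.toReal_mul]
      refine aux_div (by positivity) (by positivity) ?_
      refine (aux_rect hJ hfd hfd' hA hB (hmem s1 t1) (hmem s2 t1) (hmem s1 t2) (hmem s2 t2)
        (b2 s1 t1 t2) (b2 s2 t1 t2)).trans ?_
      have e1 := mul_le_mul_of_nonneg_left (bR s1 s2 t1 t2) (ENNReal.toReal_nonneg (a := A))
      have e2 := mul_le_mul_of_nonneg_left (b1 s1 s2 t1)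
        (show 0 ≤ B.toReal * ((hol2 θ2 x).toReal * |(t2 : ℝ) - (t1 : ℝ)| ^ θ2) by positivity)
      refine (add_le_add e1 e2).trans (le_of_eq ?_)
      ring
    refine main.trans ?_
    calc A * holRect θ1 θ2 x + B * hol2 θ2 x * hol1 θ1 x
        ≤ A * NN θ1 θ2 x + B * NN θ1 θ2 x * NN θ1 θ2 x := by gcongr
      _ ≤ A * NN θ1 θ2 x + B * NN θ1 θ2 x * NN θ1 θ2 x +
          (A * NN θ1 θ2 x * NN θ1 θ2 x + B * NN θ1 θ2 x) := le_self_add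
      _ = _ := by rw [ENNReal.ofReal_one]; ring
end
end

section
/- (Garsia–Rodemich–Rumsey inequality in the plane.) For every p > 1 and θ_1, θ_2 > 0 there exists a constant C = C(θ_1,θ_2,p) such that for every continuous function y : [0,1]^2 → ℝ, (sup_{s_1,s_2,t_1,t_2 ∈ [0,1]} |δy_{s_1 s_2;t_1 t_2}|/(|s_2-s_1|^{θ_1}|t_2-t_1|^{θ_2}))^p ≤ C ∫_{[0,1]^4} |δy_{u_1 u_2;v_1 v_2}|^p / (|u_2-u_1|^{θ_1 p + 2} |v_2-v_1|^{θ_2 p + 2}) du_1 du_2 dv_1 dv_2, where δy_{s_1 s_2;t_1 t_2} = y(s_2,t_2) - y(s_1,t_2) - y(s_2,t_1) + y(s_1,t_1) is the rectangular increment (the inequality being trivially true when the right-hand side is infinite). -/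
open Set MeasureTheory
open scoped ENNReal

noncomputable section

lemma grr_convex (p : ℝ) (hp : 1 < p) : ConvexOn ℝ univ (fun x : ℝ => |x| ^ p) := by
  refine ⟨convex_univ, fun x _ y _ a b ha hb hab => ?_⟩
  have h1 : |a • x + b • y| ≤ a • |x| + b • |y| := by
    simp only [smul_eq_mul]
    calc |a * x + b * y| ≤ |a * x| + |b * y| := abs_add_le _ _
      _ = _ := by rw [abs_mul, abs_mul, abs_of_nonneg ha, abs_of_nonneg hb]
  refine (Real.rpow_le_rpow (abs_nonneg _) h1 (by linarith)).trans ?_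
  exact (convexOn_rpow hp.le).2 (abs_nonneg x) (abs_nonneg y) ha hb hab

lemma grr_step (p κ : ℝ) (hp : 1 < p) (hκ : 0 < κ) (f : ℝ → ℝ) (hf : Continuous f)
    (S T : Set ℝ) (hS : IsCompact S) (hT : IsCompact T) (hSI : S ⊆ I01) (hTI : T ⊆ I01)
    (hS0 : 0 < volume.real S) (hT0 : 0 < volume.real T) (r : ℝ) (hr : 0 ≤ r)
    (hST : ∀ u ∈ S, ∀ v ∈ T, |v - u| ≤ r) (E : ℝ≥0∞) (hE : E ≠ ⊤)
    (hEq : E = ∫⁻ q in (I01 ×ˢ I01 : Set (ℝ × ℝ)),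
      ENNReal.ofReal (|f q.2 - f q.1| ^ p / |q.2 - q.1| ^ κ)) :
    |(⨍ v in T, f v) - ⨍ u in S, f u| ^ p ≤
      (volume.real S * volume.real T)⁻¹ * (r ^ κ * E.toReal) := by
  have hp0 : 0 < p := by linarith
  have hc : Continuous (fun q : ℝ × ℝ => f q.2 - f q.1) := by fun_prop
  have hg : Continuous (fun x : ℝ => |x| ^ p) :=
    continuous_abs.rpow_const (fun _ => Or.inr hp0.le)
  have hcpt := hS.prod hT
  have hi1 : IntegrableOn (fun q : ℝ × ℝ => f q.2 - f q.1) (S ×ˢ T) volume :=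
    hc.continuousOn.integrableOn_compact hcpt
  have hi2 : IntegrableOn ((fun x : ℝ => |x| ^ p) ∘ fun q : ℝ × ℝ => f q.2 - f q.1)
      (S ×ˢ T) volume :=
    (hg.comp hc).continuousOn.integrableOn_compact hcpt
  have hvol : volume.real (S ×ˢ T : Set (ℝ × ℝ)) = volume.real S * volume.real T :=
    measureReal_prod_prod S T
  have hvpos : 0 < volume.real (S ×ˢ T : Set (ℝ × ℝ)) := by rw [hvol]; positivity
  have hav : ⨍ q in (S ×ˢ T : Set (ℝ × ℝ)), (f q.2 - f q.1) =
      (⨍ v in T, f v) - ⨍ u in S, f u := by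
    have hfS : IntegrableOn f S volume := hf.continuousOn.integrableOn_compact hS
    have hfT : IntegrableOn f T volume := hf.continuousOn.integrableOn_compact hT
    have : ∫ q in (S ×ˢ T : Set (ℝ × ℝ)), (f q.2 - f q.1) =
        volume.real S * (∫ v in T, f v) - volume.real T * ∫ u in S, f u := by
      rw [Measure.volume_eq_prod, setIntegral_prod _ hi1]
      have : ∀ x, ∫ y in T, (f y - f x) = (∫ v in T, f v) - volume.real T * f x := by
        intro x
        rw [integral_sub hfT (by
          exact continuousOn_const.integrableOn_compact hT)]
        simp
      simp only [this]
      rw [integral_sub (continuousOn_const.integrableOn_compact hS) (hfS.const_mul _),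
        integral_const_mul]
      simp
    rw [setAverage_eq, setAverage_eq, setAverage_eq, this, hvol]
    simp only [smul_eq_mul]
    field_simp
  have hJ := (grr_convex p hp).map_set_average_le (μ := volume) (t := S ×ˢ T)
    (f := fun q : ℝ × ℝ => f q.2 - f q.1) hg.continuousOn isClosed_univ
    (by intro h; simp [Measure.real, h] at hvpos) hcpt.measure_ne_top (by simp) hi1 hi2
  rw [hav] at hJ
  refine hJ.trans ?_
  rw [setAverage_eq, hvol, smul_eq_mul]
  refine mul_le_mul_of_nonneg_left ?_ (by positivity)
  have hrE : ENNReal.ofReal (r ^ κ) * E ≠ ⊤ := ENNReal.mul_ne_top ENNReal.ofReal_ne_top hE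
  have : ENNReal.ofReal (∫ q in (S ×ˢ T : Set (ℝ × ℝ)), |f q.2 - f q.1| ^ p) ≤
      ENNReal.ofReal (r ^ κ) * E := by
    have hi3 : IntegrableOn (fun q : ℝ × ℝ => |f q.2 - f q.1| ^ p) (S ×ˢ T) volume := hi2
    rw [ofReal_integral_eq_lintegral_ofReal hi3 (Filter.Eventually.of_forall fun q => by
      simp only [Pi.zero_apply]; positivity), hEq,
      ← lintegral_const_mul' _ _ ENNReal.ofReal_ne_top]
    refine le_trans (setLIntegral_mono' (hS.measurableSet.prod hT.measurableSet) ?_)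
      (lintegral_mono_set (Set.prod_mono hSI hTI))
    rintro ⟨u, v⟩ ⟨hu, hv⟩
    rw [← ENNReal.ofReal_mul (by positivity)]
    apply ENNReal.ofReal_le_ofReal
    simp only
    rcases eq_or_ne u v with rfl | huv
    · simp [Real.zero_rpow hp0.ne', Real.zero_rpow hκ.ne']
    · have h0 : 0 < |v - u| := abs_pos.2 (sub_ne_zero.2 huv.symm)
      rw [mul_div_assoc', le_div_iff₀ (by positivity), mul_comm]
      exact mul_le_mul_of_nonneg_right
        (Real.rpow_le_rpow h0.le (hST u hu v hv) hκ.le) (by positivity)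
  have h2 := (ENNReal.ofReal_le_iff_le_toReal hrE).1 this
  rwa [ENNReal.toReal_mul, ENNReal.toReal_ofReal (by positivity)] at h2

lemma grr_half (p θ : ℝ) (hp : 1 < p) (hθ : 0 < θ) (f : ℝ → ℝ) (hf : Continuous f)
    (s t : ℝ) (hs : s ∈ I01) (ht : t ∈ I01) (hst : s ≠ t) (E : ℝ≥0∞) (hE : E ≠ ⊤)
    (hEq : E = ∫⁻ q in (I01 ×ˢ I01 : Set (ℝ × ℝ)),
      ENNReal.ofReal (|f q.2 - f q.1| ^ p / |q.2 - q.1| ^ (θ * p + 2))) :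
    |(⨍ x in uIcc s t, f x) - f s| ≤
      (2 * E.toReal) ^ p⁻¹ * |t - s| ^ θ / (1 - 2 ^ (-θ)) := by
  have hp0 : 0 < p := by linarith
  have hd : 0 < |t - s| := abs_pos.2 (sub_ne_zero.2 hst.symm)
  set z : ℕ → ℝ := fun n => s + (t - s) / 2 ^ n with hz
  set c : ℕ → ℝ := fun n => ⨍ x in uIcc s (z n), f x with hcdef
  have hvol : ∀ n, volume.real (uIcc s (z n)) = |t - s| / 2 ^ n := by
    intro n
    rw [Measure.real, Real.volume_interval, ENNReal.toReal_ofReal (abs_nonneg _)]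
    simp [hz, abs_div]
  have hzm : ∀ n, z n ∈ uIcc s t := by
    intro n
    have h1 : (1 : ℝ) ≤ 2 ^ n := one_le_pow₀ (by norm_num)
    have h2 : (0 : ℝ) ≤ (2 ^ n)⁻¹ := by positivity
    have h3 : ((2 : ℝ) ^ n)⁻¹ ≤ 1 := inv_le_one_of_one_le₀ h1
    rw [← segment_eq_uIcc]
    refine ⟨1 - (2 ^ n)⁻¹, (2 ^ n)⁻¹, by linarith, h2, by ring, ?_⟩
    simp only [hz, smul_eq_mul]; ring
  have hI : uIcc s t ⊆ I01 := by
    unfold I01 at *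
    exact Set.ordConnected_Icc.uIcc_subset hs ht
  have hsub : ∀ n, uIcc s (z n) ⊆ I01 := fun n =>
    (uIcc_subset_uIcc left_mem_uIcc (hzm n)).trans hI
  have hdist : ∀ n, ∀ x ∈ uIcc s (z n), |x - s| ≤ |t - s| / 2 ^ n := by
    intro n x hx
    have := abs_sub_left_of_mem_uIcc hx
    refine this.trans (le_of_eq ?_)
    simp [hz, abs_div]
  have hnest : ∀ n, uIcc s (z (n+1)) ⊆ uIcc s (z n) := by
    intro n
    refine uIcc_subset_uIcc left_mem_uIcc ?_
    rw [← segment_eq_uIcc]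
    refine ⟨1/2, 1/2, by norm_num, by norm_num, by norm_num, ?_⟩
    simp only [hz, smul_eq_mul, pow_succ]; field_simp; ring
  have hlim : Filter.Tendsto c Filter.atTop (nhds (f s)) := by
    rw [Metric.tendsto_atTop]
    intro ε hε
    obtain ⟨δ, hδ, hδ'⟩ := Metric.continuous_iff.1 hf s (ε / 2) (by positivity)
    have hl : Filter.Tendsto (fun n : ℕ => |t - s| * (1 / 2 : ℝ) ^ n) Filter.atTop
        (nhds (|t - s| * 0)) :=
      (tendsto_pow_atTop_nhds_zero_of_lt_one (by norm_num) (by norm_num)).const_mul _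
    rw [mul_zero] at hl
    obtain ⟨N, hN⟩ := (hl.eventually (gt_mem_nhds hδ)).exists_forall_of_atTop
    refine ⟨N, fun n hn => ?_⟩
    have hmem : c n ∈ Metric.closedBall (f s) (ε / 2) := by
      refine Convex.set_average_mem (convex_closedBall _ _) Metric.isClosed_closedBall
        ?_ isCompact_uIcc.measure_ne_top ?_ hf.integrableOn_uIcc
      · intro h
        have := hvol n
        rw [Measure.real, h] at this
        have h' : 0 < |t - s| / 2 ^ n := by positivity
        simp at this
        rw [← this] at h'
        simp at h'
      · refine (ae_restrict_iff' measurableSet_uIcc).2 (Filter.Eventually.of_forall fun x hx => ?_)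
        refine (hδ' x ?_).le
        refine lt_of_le_of_lt (hdist n x hx) ?_
        have := hN n hn
        rwa [one_div_pow, mul_one_div] at this
    have := Metric.mem_closedBall.1 hmem
    linarith
  have hstep : ∀ n, dist (c n) (c (n+1)) ≤
      ((2 * E.toReal) ^ p⁻¹ * |t - s| ^ θ) * ((2 : ℝ) ^ (-θ)) ^ n := by
    intro n
    set l := |t - s| / 2 ^ n with hl
    have hl0 : 0 < l := by positivity
    have hl2 : volume.real (uIcc s (z (n+1))) = l / 2 := by
      rw [hvol, hl, pow_succ]; field_simp
    have h := grr_step p (θ * p + 2) hp (by positivity) f hf (uIcc s (z n)) (uIcc s (z (n+1)))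
      isCompact_uIcc isCompact_uIcc (hsub n) (hsub (n+1))
      (by rw [hvol]; positivity) (by rw [hl2]; positivity) l hl0.le
      (fun u hu v hv => by
        have := abs_sub_le_of_uIcc_subset_uIcc (uIcc_subset_uIcc hu (hnest n hv))
        refine this.trans (le_of_eq ?_)
        simp [hz, hl, abs_div]) E hE hEq
    rw [hvol, hl2, ← hl] at h
    have hEn : 0 ≤ E.toReal := ENNReal.toReal_nonneg
    have e1 : (l * (l / 2))⁻¹ * (l ^ (θ * p + 2) * E.toReal) = 2 * E.toReal * l ^ (θ * p) := by
      rw [Real.rpow_add hl0, Real.rpow_two]; field_simp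
    have e2 : ((2 * E.toReal) ^ p⁻¹ * |t - s| ^ θ) * ((2 : ℝ) ^ (-θ)) ^ n =
        (2 * E.toReal) ^ p⁻¹ * l ^ θ := by
      rw [hl, Real.div_rpow (by positivity) (by positivity), Real.rpow_neg (by norm_num),
        inv_pow, ← Real.rpow_natCast, ← Real.rpow_natCast, ← Real.rpow_mul (by norm_num),
        ← Real.rpow_mul (by norm_num), mul_comm θ]
      ring
    rw [dist_comm, Real.dist_eq, e2, ← Real.rpow_le_rpow_iff (abs_nonneg _) (by positivity) hp0]
    refine h.trans (le_of_eq ?_)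
    rw [e1, Real.mul_rpow (by positivity) (by positivity), ← Real.rpow_mul (by positivity),
      inv_mul_cancel₀ hp0.ne', Real.rpow_one, ← Real.rpow_mul hl0.le]
  have := dist_le_of_le_geometric_of_tendsto₀ _ _
    (Real.rpow_lt_one_of_one_lt_of_neg (by norm_num) (by linarith)) hstep hlim
  have hz0 : z 0 = t := by simp [hz]
  simpa [hcdef, hz0, Real.dist_eq] using this

lemma grr_one (p θ : ℝ) (hp : 1 < p) (hθ : 0 < θ) :
    ∃ C : ℝ, 0 < C ∧ ∀ f : ℝ → ℝ, Continuous f → ∀ s ∈ I01, ∀ t ∈ I01,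
      ENNReal.ofReal (|f t - f s| ^ p / |t - s| ^ (θ * p)) ≤ ENNReal.ofReal C *
        ∫⁻ q in (I01 ×ˢ I01 : Set (ℝ × ℝ)),
          ENNReal.ofReal (|f q.2 - f q.1| ^ p / |q.2 - q.1| ^ (θ * p + 2)) := by
  have hp0 : 0 < p := by linarith
  have hρ : (2 : ℝ) ^ (-θ) < 1 := Real.rpow_lt_one_of_one_lt_of_neg (by norm_num) (by linarith)
  have hρ' : 0 < 1 - (2 : ℝ) ^ (-θ) := by linarith
  set D : ℝ := 2 / (1 - (2 : ℝ) ^ (-θ)) with hD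
  have hD0 : 0 < D := by positivity
  refine ⟨D ^ p * 2, by positivity, fun f hf s hs t ht => ?_⟩
  rcases eq_or_ne s t with rfl | hst
  · simp [Real.zero_rpow hp0.ne']
  set E := ∫⁻ q in (I01 ×ˢ I01 : Set (ℝ × ℝ)),
          ENNReal.ofReal (|f q.2 - f q.1| ^ p / |q.2 - q.1| ^ (θ * p + 2)) with hEq
  by_cases hE : E = ⊤
  · rw [hE, ENNReal.mul_top (by simp; positivity)]
    exact le_top
  have hEn : 0 ≤ E.toReal := ENNReal.toReal_nonneg
  have hd : 0 < |t - s| := abs_pos.2 (sub_ne_zero.2 hst.symm)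
  have h1 := grr_half p θ hp hθ f hf s t hs ht hst E hE hEq
  have h2 := grr_half p θ hp hθ f hf t s ht hs hst.symm E hE hEq
  rw [uIcc_comm, abs_sub_comm s t] at h2
  have h3 : |f t - f s| ≤ D * ((2 * E.toReal) ^ p⁻¹ * |t - s| ^ θ) := by
    have : D * ((2 * E.toReal) ^ p⁻¹ * |t - s| ^ θ) =
      (2 * E.toReal) ^ p⁻¹ * |t - s| ^ θ / (1 - 2 ^ (-θ)) +
      (2 * E.toReal) ^ p⁻¹ * |t - s| ^ θ / (1 - 2 ^ (-θ)) := by rw [hD]; ring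
    rw [this]
    refine le_trans ?_ (add_le_add h1 h2)
    rw [abs_sub_comm _ (f t), add_comm]
    exact abs_sub_le _ _ _
  have h4 := Real.rpow_le_rpow (abs_nonneg _) h3 hp0.le
  rw [Real.mul_rpow (by positivity) (by positivity), Real.mul_rpow (by positivity) (by positivity),
    ← Real.rpow_mul (by positivity), inv_mul_cancel₀ hp0.ne', Real.rpow_one,
    ← Real.rpow_mul hd.le] at h4
  rw [← ENNReal.ofReal_toReal hE, ← ENNReal.ofReal_mul (by positivity)]
  apply ENNReal.ofReal_le_ofReal
  rw [div_le_iff₀ (by positivity)]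
  linarith

lemma grr_plane_cont (p θ1 θ2 : ℝ) (hp : 1 < p) (hθ1 : 0 < θ1) (hθ2 : 0 < θ2) :
    ∃ C : ℝ, ∀ y : ℝ → ℝ → ℝ, Continuous (fun q : ℝ × ℝ => y q.1 q.2) →
      ∀ s1 ∈ I01, ∀ s2 ∈ I01, ∀ t1 ∈ I01, ∀ t2 ∈ I01,
      ENNReal.ofReal (|dRect y s1 s2 t1 t2| ^ p /
        (|s2 - s1| ^ (θ1 * p) * |t2 - t1| ^ (θ2 * p))) ≤
        ENNReal.ofReal C *
          ∫⁻ q in (I01 ×ˢ I01 ×ˢ I01 ×ˢ I01 : Set (ℝ × ℝ × ℝ × ℝ)),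
            ENNReal.ofReal (|dRect y q.1 q.2.1 q.2.2.1 q.2.2.2| ^ p /
              (|q.2.1 - q.1| ^ (θ1 * p + 2) * |q.2.2.2 - q.2.2.1| ^ (θ2 * p + 2))) := by
  obtain ⟨C1, hC1, H1⟩ := grr_one p θ1 hp hθ1
  obtain ⟨C2, hC2, H2⟩ := grr_one p θ2 hp hθ2
  refine ⟨C1 * C2, fun y hy s1 hs1 s2 hs2 t1 ht1 t2 ht2 => ?_⟩
  have hy1 : ∀ t, Continuous fun s => y s t := fun t =>
    hy.comp (continuous_id.prodMk continuous_const)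
  have hy2 : ∀ s, Continuous fun t => y s t := fun s =>
    hy.comp (continuous_const.prodMk continuous_id)
  have hm : MeasurableSet I01 := measurableSet_Icc
  have hym : ∀ g h : (ℝ × ℝ × ℝ × ℝ) → ℝ, Measurable g → Measurable h →
      Measurable fun q => y (g q) (h q) := fun g h hg hh =>
    hy.measurable.comp (hg.prodMk hh)
  set F : ℝ × ℝ × ℝ × ℝ → ℝ≥0∞ := fun q =>
    ENNReal.ofReal (|dRect y q.1 q.2.1 q.2.2.1 q.2.2.2| ^ p /
              (|q.2.1 - q.1| ^ (θ1 * p + 2) * |q.2.2.2 - q.2.2.1| ^ (θ2 * p + 2))) with hF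
  have hdm : Measurable fun q : ℝ × ℝ × ℝ × ℝ => dRect y q.1 q.2.1 q.2.2.1 q.2.2.2 := by
    unfold dRect
    refine Measurable.add (Measurable.sub (Measurable.sub ?_ ?_) ?_) ?_ <;>
      exact hym _ _ (by fun_prop) (by fun_prop)
  have habs : Measurable fun x : ℝ => |x| := continuous_abs.measurable
  have hFm : Measurable F := by
    refine ENNReal.measurable_ofReal.comp ?_
    refine ((habs.comp hdm).pow_const p).div ?_
    exact ((habs.comp (by fun_prop : Measurable fun q : ℝ × ℝ × ℝ × ℝ => q.2.1 - q.1)).pow_const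
      _).mul ((habs.comp (by fun_prop :
        Measurable fun q : ℝ × ℝ × ℝ × ℝ => q.2.2.2 - q.2.2.1)).pow_const _)
  have hFub : ∫⁻ q in (I01 ×ˢ I01 ×ˢ I01 ×ˢ I01 : Set (ℝ × ℝ × ℝ × ℝ)), F q =
      ∫⁻ u1 in I01, ∫⁻ u2 in I01, ∫⁻ v in (I01 ×ˢ I01 : Set (ℝ × ℝ)), F (u1, u2, v) := by
    rw [Measure.volume_eq_prod, setLIntegral_prod _ hFm.aemeasurable]
    refine lintegral_congr fun u1 => ?_
    rw [Measure.volume_eq_prod, setLIntegral_prod _ (by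
      exact (hFm.comp measurable_prodMk_left).aemeasurable)]
  -- one-dimensional estimates
  have A : ENNReal.ofReal (|dRect y s1 s2 t1 t2| ^ p / |s2 - s1| ^ (θ1 * p)) ≤
      ENNReal.ofReal C1 * ∫⁻ u1 in I01, ∫⁻ u2 in I01,
        ENNReal.ofReal (|dRect y u1 u2 t1 t2| ^ p / |u2 - u1| ^ (θ1 * p + 2)) := by
    have hfc : Continuous fun s => y s t2 - y s t1 := (hy1 t2).sub (hy1 t1)
    have h := H1 (fun s => y s t2 - y s t1) hfc s1 hs1 s2 hs2
    have e : ∀ u1 u2, y u2 t2 - y u2 t1 - (y u1 t2 - y u1 t1) = dRect y u1 u2 t1 t2 := by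
      intro u1 u2; unfold dRect; ring
    have hmm : Measurable fun q : ℝ × ℝ => ENNReal.ofReal
        (|y q.2 t2 - y q.2 t1 - (y q.1 t2 - y q.1 t1)| ^ p / |q.2 - q.1| ^ (θ1 * p + 2)) := by
      refine ENNReal.measurable_ofReal.comp ?_
      refine ((habs.comp ?_).pow_const p).div
        ((habs.comp (by fun_prop : Measurable fun q : ℝ × ℝ => q.2 - q.1)).pow_const _)
      exact ((hfc.comp continuous_snd).sub (hfc.comp continuous_fst)).measurable
    rw [Measure.volume_eq_prod, setLIntegral_prod _ hmm.aemeasurable] at h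
    simpa only [e] using h
  have B : ∀ u1 u2, ENNReal.ofReal (|t2 - t1| ^ (θ2 * p))⁻¹ *
      ENNReal.ofReal (|dRect y u1 u2 t1 t2| ^ p / |u2 - u1| ^ (θ1 * p + 2)) ≤
      ENNReal.ofReal C2 * ∫⁻ v in (I01 ×ˢ I01 : Set (ℝ × ℝ)), F (u1, u2, v) := by
    intro u1 u2
    have h := H2 (fun t => y u2 t - y u1 t) ((hy2 u2).sub (hy2 u1)) t1 ht1 t2 ht2
    have e : ∀ v1 v2, y u2 v2 - y u1 v2 - (y u2 v1 - y u1 v1) = dRect y u1 u2 v1 v2 := by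
      intro u1 u2; unfold dRect; ring
    simp only [e] at h
    have h' := mul_le_mul_right h (ENNReal.ofReal (|u2 - u1| ^ (θ1 * p + 2))⁻¹)
    rw [mul_left_comm, ← lintegral_const_mul' _ _ ENNReal.ofReal_ne_top,
      ← ENNReal.ofReal_mul (by positivity)] at h'
    rw [← ENNReal.ofReal_mul (by positivity)]
    refine le_trans (le_of_eq ?_) (h'.trans (le_of_eq ?_))
    · congr 1; ring
    · congr 1
      refine lintegral_congr fun v => ?_
      rw [hF, ← ENNReal.ofReal_mul (by positivity)]
      congr 1
      simp only [div_eq_mul_inv, mul_inv]; ring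
  rw [hFub]
  have A' := mul_le_mul_right A (ENNReal.ofReal (|t2 - t1| ^ (θ2 * p))⁻¹)
  rw [← ENNReal.ofReal_mul (by positivity), mul_left_comm,
    ← lintegral_const_mul' _ _ ENNReal.ofReal_ne_top] at A'
  simp only [← lintegral_const_mul' _ _ (ENNReal.ofReal_ne_top (r := (|t2 - t1| ^ (θ2 * p))⁻¹))]
    at A'
  refine le_trans (le_of_eq ?_) (A'.trans ?_)
  · congr 1; simp only [div_eq_mul_inv, mul_inv]; ring
  rw [ENNReal.ofReal_mul hC1.le, mul_assoc]
  refine mul_le_mul_right ?_ _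
  rw [← lintegral_const_mul' _ _ ENNReal.ofReal_ne_top]
  refine lintegral_mono fun u1 => ?_
  rw [← lintegral_const_mul' _ _ ENNReal.ofReal_ne_top]
  exact lintegral_mono fun u2 => B u1 u2

theorem garsia_rodemich_rumsey_plane
    (p θ1 θ2 : ℝ) (hp : 1 < p) (hθ1 : 0 < θ1) (hθ2 : 0 < θ2) :
    ∃ C : ℝ, ∀ y : ℝ → ℝ → ℝ,
      ContinuousOn (fun q : ℝ × ℝ => y q.1 q.2) (I01 ×ˢ I01) →
      holRect θ1 θ2 y ^ p ≤
        ENNReal.ofReal C *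
          ∫⁻ q in (I01 ×ˢ I01 ×ˢ I01 ×ˢ I01 : Set (ℝ × ℝ × ℝ × ℝ)),
            ENNReal.ofReal (|dRect y q.1 q.2.1 q.2.2.1 q.2.2.2| ^ p /
              (|q.2.1 - q.1| ^ (θ1 * p + 2) * |q.2.2.2 - q.2.2.1| ^ (θ2 * p + 2))) := by
  have hp0 : 0 < p := by linarith
  obtain ⟨C, hC⟩ := grr_plane_cont p θ1 θ2 hp hθ1 hθ2
  refine ⟨C, fun y hy => ?_⟩
  have hm : MeasurableSet I01 := measurableSet_Icc
  let π : ℝ → ℝ := fun x => (projIcc (0 : ℝ) 1 zero_le_one x : ℝ)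
  have hπc : Continuous π := continuous_subtype_val.comp continuous_projIcc
  have hπm : ∀ x, π x ∈ I01 := fun x => (projIcc (0 : ℝ) 1 zero_le_one x).2
  have hπ : ∀ x ∈ I01, π x = x := fun x hx => by
    simp only [π]; rw [projIcc_of_mem _ hx]
  let w : ℝ → ℝ → ℝ := fun a b => y (π a) (π b)
  have hw : Continuous (fun q : ℝ × ℝ => w q.1 q.2) :=
    hy.comp_continuous (f := fun q : ℝ × ℝ => (π q.1, π q.2)) (by fun_prop)
      (fun q => ⟨hπm _, hπm _⟩)
  have hdw : ∀ a ∈ I01, ∀ b ∈ I01, ∀ c ∈ I01, ∀ d ∈ I01, dRect w a b c d = dRect y a b c d := by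
    intro a ha b hb c hc d hd
    simp only [dRect, w, hπ a ha, hπ b hb, hπ c hc, hπ d hd]
  have hint : ∫⁻ q in (I01 ×ˢ I01 ×ˢ I01 ×ˢ I01 : Set (ℝ × ℝ × ℝ × ℝ)),
            ENNReal.ofReal (|dRect y q.1 q.2.1 q.2.2.1 q.2.2.2| ^ p /
              (|q.2.1 - q.1| ^ (θ1 * p + 2) * |q.2.2.2 - q.2.2.1| ^ (θ2 * p + 2))) =
      ∫⁻ q in (I01 ×ˢ I01 ×ˢ I01 ×ˢ I01 : Set (ℝ × ℝ × ℝ × ℝ)),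
            ENNReal.ofReal (|dRect w q.1 q.2.1 q.2.2.1 q.2.2.2| ^ p /
              (|q.2.1 - q.1| ^ (θ1 * p + 2) * |q.2.2.2 - q.2.2.1| ^ (θ2 * p + 2))) := by
    refine setLIntegral_congr_fun (hm.prod (hm.prod (hm.prod hm))) ?_
    rintro ⟨a, b, c, d⟩ ⟨ha, hb, hc, hd⟩
    simp only
    rw [hdw a ha b hb c hc d hd]
  rw [hint, ← ENNReal.le_rpow_inv_iff hp0]
  refine iSup_le fun s1 => iSup_le fun s2 => iSup_le fun t1 => iSup_le fun t2 => ?_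
  rw [ENNReal.le_rpow_inv_iff hp0]
  refine le_trans (le_of_eq ?_) (hC w hw s1 s1.2 s2 s2.2 t1 t1.2 t2 t2.2)
  rw [ENNReal.ofReal_rpow_of_nonneg (by positivity) hp0.le, hdw _ s1.2 _ s2.2 _ t1.2 _ t2.2,
    Real.div_rpow (by positivity) (by positivity), Real.mul_rpow (by positivity) (by positivity),
    ← Real.rpow_mul (abs_nonneg _), ← Real.rpow_mul (abs_nonneg _)]
end
end

section
/- (Composition estimate with exponential growth.) Let ρ_1, ρ_2 ∈ (0,1) and c, λ > 0, and let f ∈ C^3(ℝ,ℝ) satisfy |f^{(l)}(ξ)| ≤ c e^{λ ξ^2} for l = 0,1,2,3 and all ξ ∈ ℝ. Then there exist constants C and θ, depending only on c, λ, ρ_1, ρ_2, such that for all continuous x^1, x^2 : [0,1]^2 → ℝ with N_{ρ_1,ρ_2}(x^1) < ∞ and N_{ρ_1,ρ_2}(x^2) < ∞, N_{ρ_1,ρ_2}(f∘x^1 - f∘x^2) ≤ C exp(θ(||x^1||_∞^2 + ||x^2||_∞^2)) · N_{ρ_1,ρ_2}(x^1 - x^2) · (1 + N_{ρ_1,ρ_2}(x^1)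 + N_{ρ_1,ρ_2}(x^2))^2. -/
open Set Filter
open scoped ENNReal Topology

noncomputable section

lemma cvx_abs {θ u v P : ℝ} (h0 : 0 ≤ θ) (h1 : θ ≤ 1) (hu : |u| ≤ P) (hv : |v| ≤ P) :
    |v + θ * (u - v)| ≤ P := by
  rw [abs_le] at *
  constructor <;> nlinarith [hu.1, hu.2, hv.1, hv.2]

lemma lip_of_deriv {f f1 : ℝ → ℝ} {R K : ℝ} (hf : ∀ x, HasDerivAt f (f1 x) x)
    (hK : ∀ x, |x| ≤ R → |f1 x| ≤ K) {a b : ℝ} (ha : |a| ≤ R) (hb : |b| ≤ R) :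
    |f a - f b| ≤ K * |a - b| := by
  have h := Convex.norm_image_sub_le_of_norm_hasDerivWithin_le (f := f) (f' := f1)
    (s := Set.Icc (-R) R) (C := K) (x := b) (y := a)
    (fun x _ => (hf x).hasDerivWithinAt)
    (fun x hx => by simpa using hK x (abs_le.2 hx)) (convex_Icc _ _)
    (abs_le.1 hb) (abs_le.1 ha)
  simpa [Real.norm_eq_abs] using h

lemma mv_unit {g g1 : ℝ → ℝ} {B : ℝ} (hg : ∀ x, HasDerivAt g (g1 x) x)
    (hB : ∀ x, 0 ≤ x → x ≤ 1 → |g1 x| ≤ B) : |g 1 - g 0| ≤ B := by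
  have h := Convex.norm_image_sub_le_of_norm_hasDerivWithin_le (f := g) (f' := g1)
    (s := Set.Icc 0 1) (C := B) (x := 0) (y := 1)
    (fun x _ => (hg x).hasDerivWithinAt)
    (fun x hx => by simpa using hB x hx.1 hx.2) (convex_Icc _ _)
    (by simp) (by simp)
  simpa [Real.norm_eq_abs] using h

lemma path_deriv {f f1 : ℝ → ℝ} (hf : ∀ x, HasDerivAt f (f1 x) x) (a b θ : ℝ) :
    HasDerivAt (fun θ => f (b + θ * (a - b))) (f1 (b + θ * (a - b)) * (a - b)) θ := by
  have h1 : HasDerivAt (fun θ : ℝ => b + θ * (a - b)) (a - b) θ := by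
    simpa using ((hasDerivAt_id θ).mul_const (a - b)).const_add b
  exact (hf _).comp θ h1

lemma four_pt {f f1 f2 : ℝ → ℝ} {R K P a1 a2 b1 b2 : ℝ} (hK0 : 0 ≤ K)
    (hf : ∀ x, HasDerivAt f (f1 x) x) (hf1 : ∀ x, HasDerivAt f1 (f2 x) x)
    (hK1 : ∀ x, |x| ≤ R → |f1 x| ≤ K) (hK2 : ∀ x, |x| ≤ R → |f2 x| ≤ K)
    (ha1 : |a1| ≤ R) (ha2 : |a2| ≤ R) (hb1 : |b1| ≤ R) (hb2 : |b2| ≤ R)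
    (ha : |a2 - a1| ≤ P) (hb : |b2 - b1| ≤ P) :
    |f a2 - f b2 - f a1 + f b1| ≤ K * |a2 - b2 - a1 + b1| + K * P * |a1 - b1| := by
  have h := mv_unit (B := K * |a2 - b2 - a1 + b1| + K * P * |a1 - b1|)
    (fun θ => (path_deriv hf a2 b2 θ).sub (path_deriv hf a1 b1 θ)) ?_
  · have e : f a2 - f b2 - f a1 + f b1 = (f a2 - f a1) - (f b2 - f b1) := by ring
    rw [e]; simpa using h
  intro θ h0 h1
  have z1 := cvx_abs h0 h1 ha1 hb1
  have z2 := cvx_abs h0 h1 ha2 hb2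
  have dz := cvx_abs h0 h1 ha hb
  have hl := lip_of_deriv hf1 hK2 z2 z1
  rw [show b2 + θ * (a2 - b2) - (b1 + θ * (a1 - b1)) =
    b2 - b1 + θ * (a2 - a1 - (b2 - b1)) by ring] at hl
  have hl' := hl.trans (mul_le_mul_of_nonneg_left dz hK0)
  have e : f1 (b2 + θ * (a2 - b2)) * (a2 - b2) - f1 (b1 + θ * (a1 - b1)) * (a1 - b1)
    = f1 (b2 + θ * (a2 - b2)) * (a2 - b2 - a1 + b1) +
      (f1 (b2 + θ * (a2 - b2)) - f1 (b1 + θ * (a1 - b1))) * (a1 - b1) := by ring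
  rw [e]
  refine (abs_add_le _ _).trans ?_
  rw [abs_mul, abs_mul]
  gcongr
  exact hK1 _ z2

lemma eight_pt {f f1 f2 f3 : ℝ → ℝ} {R K M N p q a11 a12 a21 a22 b11 b12 b21 b22 : ℝ}
    (hK0 : 0 ≤ K) (hM : 0 ≤ M) (hN : 0 ≤ N) (hp : 0 ≤ p) (hq : 0 ≤ q)
    (hf : ∀ x, HasDerivAt f (f1 x) x) (hf1 : ∀ x, HasDerivAt f1 (f2 x) x)
    (hf2 : ∀ x, HasDerivAt f2 (f3 x) x)
    (hK1 : ∀ x, |x| ≤ R → |f1 x| ≤ K) (hK2 : ∀ x, |x| ≤ R → |f2 x| ≤ K)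
    (hK3 : ∀ x, |x| ≤ R → |f3 x| ≤ K)
    (ha11 : |a11| ≤ R) (ha12 : |a12| ≤ R) (ha21 : |a21| ≤ R) (ha22 : |a22| ≤ R)
    (hb11 : |b11| ≤ R) (hb12 : |b12| ≤ R) (hb21 : |b21| ≤ R) (hb22 : |b22| ≤ R)
    (ha1 : |a21 - a11| ≤ M * p)
    (ha3 : |a22 - a21| ≤ M * q) (ha4 : |a12 - a11| ≤ M * q)
    (ha5 : |a22 - a12 - a21 + a11| ≤ M * (p * q))
    (hb1 : |b21 - b11| ≤ M * p)
    (hb3 : |b22 - b21| ≤ M * q) (hb4 : |b12 - b11| ≤ M * q)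
    (hb5 : |b22 - b12 - b21 + b11| ≤ M * (p * q))
    (hd0 : |a22 - b22| ≤ N) (hd1 : |(a22 - b22) - (a12 - b12)| ≤ N * p)
    (hd2 : |(a22 - b22) - (a21 - b21)| ≤ N * q)
    (hd3 : |(a22 - b22) - (a12 - b12) - (a21 - b21) + (a11 - b11)| ≤ N * (p * q)) :
    |(f a22 - f b22) - (f a12 - f b12) - (f a21 - f b21) + (f a11 - f b11)| ≤
      K * N * (1 + 3 * M + M ^ 2) * (p * q) := by
  have h := mv_unit (B := K * N * (1 + 3 * M + M ^ 2) * (p * q))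
    (fun θ => (((path_deriv hf a22 b22 θ).sub (path_deriv hf a12 b12 θ)).sub
      (path_deriv hf a21 b21 θ)).add (path_deriv hf a11 b11 θ)) ?_
  · have e : (f a22 - f b22) - (f a12 - f b12) - (f a21 - f b21) + (f a11 - f b11) =
      (f a22 - f a12 - f a21 + f a11) - (f b22 - f b12 - f b21 + f b11) := by ring
    rw [e]; simpa using h
  intro θ h0 h1
  have z11 := cvx_abs h0 h1 ha11 hb11
  have z12 := cvx_abs h0 h1 ha12 hb12
  have z21 := cvx_abs h0 h1 ha21 hb21
  have z22 := cvx_abs h0 h1 ha22 hb22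
  have d1 := cvx_abs h0 h1 ha1 hb1
  have d3 := cvx_abs h0 h1 ha3 hb3
  have d4 := cvx_abs h0 h1 ha4 hb4
  have d5 := cvx_abs h0 h1 ha5 hb5
  rw [show b21 - b11 + θ * (a21 - a11 - (b21 - b11)) =
    (b21 + θ * (a21 - b21)) - (b11 + θ * (a11 - b11)) by ring] at d1
  rw [show b22 - b21 + θ * (a22 - a21 - (b22 - b21)) =
    (b22 + θ * (a22 - b22)) - (b21 + θ * (a21 - b21)) by ring] at d3
  rw [show b12 - b11 + θ * (a12 - a11 - (b12 - b11)) =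
    (b12 + θ * (a12 - b12)) - (b11 + θ * (a11 - b11)) by ring] at d4
  rw [show b22 - b12 - b21 + b11 + θ * (a22 - a12 - a21 + a11 - (b22 - b12 - b21 + b11)) =
    (b22 + θ * (a22 - b22)) - (b12 + θ * (a12 - b12)) - (b21 + θ * (a21 - b21))
      + (b11 + θ * (a11 - b11)) by ring] at d5
  generalize b11 + θ * (a11 - b11) = w11 at *
  generalize b12 + θ * (a12 - b12) = w12 at *
  generalize b21 + θ * (a21 - b21) = w21 at *
  generalize b22 + θ * (a22 - b22) = w22 at *
  generalize a11 - b11 = v11 at *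
  generalize a12 - b12 = v12 at *
  generalize a21 - b21 = v21 at *
  generalize a22 - b22 = v22 at *
  have u0 := hK1 _ z11
  have u1 : |f1 w21 - f1 w11| ≤ K * (M * p) := (lip_of_deriv hf1 hK2 z21 z11).trans (by gcongr)
  have u2 : |f1 w12 - f1 w11| ≤ K * (M * q) := (lip_of_deriv hf1 hK2 z12 z11).trans (by gcongr)
  have u3 : |f1 w22 - f1 w12 - f1 w21 + f1 w11| ≤ K * (M * (p * q)) + K * (M * q) * (M * p) :=
    (four_pt hK0 hf1 hf2 hK2 hK3 z21 z22 z11 z12 d3 d4).trans (by gcongr)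
  have e : f1 w22 * v22 - f1 w12 * v12 - f1 w21 * v21 + f1 w11 * v11 =
    (f1 w22 - f1 w12 - f1 w21 + f1 w11) * v22 + (f1 w12 - f1 w11) * (v22 - v12) +
    (f1 w21 - f1 w11) * (v22 - v21) + f1 w11 * (v22 - v12 - v21 + v11) := by ring
  rw [e]
  calc _ ≤ |(f1 w22 - f1 w12 - f1 w21 + f1 w11) * v22| + |(f1 w12 - f1 w11) * (v22 - v12)| +
    |(f1 w21 - f1 w11) * (v22 - v21)| + |f1 w11 * (v22 - v12 - v21 + v11)| := by
        refine (abs_add_le _ _).trans (add_le_add_left ?_ _)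
        refine (abs_add_le _ _).trans (add_le_add_left ?_ _)
        exact abs_add_le _ _
    _ ≤ (K * (M * (p * q)) + K * (M * q) * (M * p)) * N + K * (M * q) * (N * p) +
      K * (M * p) * (N * q) + K * (N * (p * q)) := by
        simp only [abs_mul]; gcongr
    _ = _ := by ring

lemma nn_bounds {r1 r2 : ℝ} (h1 : 0 < r1) (h2 : 0 < r2) {f : ℝ → ℝ → ℝ}
    (hf : NN r1 r2 f ≠ ⊤) :
    (∀ s1 ∈ I01, ∀ s2 ∈ I01, ∀ t1 ∈ I01, ∀ t2 ∈ I01, |dRect f s1 s2 t1 t2| ≤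
      (NN r1 r2 f).toReal * (|s2 - s1| ^ r1 * |t2 - t1| ^ r2)) ∧
    (∀ s1 ∈ I01, ∀ s2 ∈ I01, ∀ t ∈ I01, |d1 f s1 s2 t| ≤
      (NN r1 r2 f).toReal * |s2 - s1| ^ r1) ∧
    (∀ s ∈ I01, ∀ t1 ∈ I01, ∀ t2 ∈ I01, |d2 f s t1 t2| ≤
      (NN r1 r2 f).toReal * |t2 - t1| ^ r2) ∧
    (∀ s ∈ I01, ∀ t ∈ I01, |f s t| ≤ (NN r1 r2 f).toReal) ∧
    (∀ s ∈ I01, ∀ t ∈ I01, |f s t| ≤ (holInf f).toReal) := by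
  have key : ∀ (x : ℝ) (A : ℝ≥0∞), A ≤ NN r1 r2 f → ENNReal.ofReal x ≤ A →
      x ≤ (NN r1 r2 f).toReal := fun x A hA hx => by
    rw [← ENNReal.ofReal_le_iff_le_toReal hf]; exact hx.trans hA
  have i1 : holRect r1 r2 f ≤ NN r1 r2 f := by
    unfold NN; rw [add_assoc, add_assoc]; exact le_self_add
  have i2 : hol1 r1 f ≤ NN r1 r2 f := by
    unfold NN; rw [add_assoc]; exact le_add_self.trans le_self_add
  have i3 : hol2 r2 f ≤ NN r1 r2 f := by
    unfold NN; exact le_add_self.trans le_self_add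
  have i4 : holInf f ≤ NN r1 r2 f := by
    unfold NN; exact le_add_self
  have pos : ∀ {x y r : ℝ}, x ≠ y → 0 < |x - y| ^ r := fun h =>
    Real.rpow_pos_of_pos (abs_pos.2 (sub_ne_zero.2 h)) _
  refine ⟨?_, ?_, ?_, ?_, ?_⟩
  · intro s1 hs1 s2 hs2 t1 ht1 t2 ht2
    by_cases hs : s2 = s1
    · subst hs; simp [dRect, Real.zero_rpow h1.ne']
    by_cases ht : t2 = t1
    · subst ht; simp [dRect, Real.zero_rpow h2.ne']
    rw [← div_le_iff₀ (mul_pos (pos hs) (pos ht))]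
    refine key _ _ i1 ?_
    exact le_iSup_of_le ⟨s1, hs1⟩ <| le_iSup_of_le ⟨s2, hs2⟩ <|
      le_iSup_of_le ⟨t1, ht1⟩ <| le_iSup_of_le ⟨t2, ht2⟩ le_rfl
  · intro s1 hs1 s2 hs2 t ht
    by_cases hs : s2 = s1
    · subst hs; simp [d1, Real.zero_rpow h1.ne']
    rw [← div_le_iff₀ (pos hs)]
    refine key _ _ i2 ?_
    exact le_iSup_of_le ⟨s1, hs1⟩ <| le_iSup_of_le ⟨s2, hs2⟩ <| le_iSup_of_le ⟨t, ht⟩ le_rfl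
  · intro s hs t1 ht1 t2 ht2
    by_cases ht : t2 = t1
    · subst ht; simp [d2, Real.zero_rpow h2.ne']
    rw [← div_le_iff₀ (pos ht)]
    refine key _ _ i3 ?_
    exact le_iSup_of_le ⟨s, hs⟩ <| le_iSup_of_le ⟨t1, ht1⟩ <| le_iSup_of_le ⟨t2, ht2⟩ le_rfl
  · intro s hs t ht
    refine key _ _ i4 ?_
    exact le_iSup_of_le ⟨s, hs⟩ <| le_iSup_of_le ⟨t, ht⟩ le_rfl
  · intro s hs t ht
    rw [← ENNReal.ofReal_le_iff_le_toReal (ne_top_of_le_ne_top hf i4)]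
    exact le_iSup_of_le ⟨s, hs⟩ <| le_iSup_of_le ⟨t, ht⟩ le_rfl

lemma nn_le {r1 r2 A1 A2 A3 A4 : ℝ} {f : ℝ → ℝ → ℝ}
    (p1 : 0 ≤ A1) (p2 : 0 ≤ A2) (p3 : 0 ≤ A3) (p4 : 0 ≤ A4)
    (h1 : ∀ s1 ∈ I01, ∀ s2 ∈ I01, ∀ t1 ∈ I01, ∀ t2 ∈ I01, |dRect f s1 s2 t1 t2| ≤
      A1 * (|s2 - s1| ^ r1 * |t2 - t1| ^ r2))
    (h2 : ∀ s1 ∈ I01, ∀ s2 ∈ I01, ∀ t ∈ I01, |d1 f s1 s2 t| ≤ A2 * |s2 - s1| ^ r1)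
    (h3 : ∀ s ∈ I01, ∀ t1 ∈ I01, ∀ t2 ∈ I01, |d2 f s t1 t2| ≤ A3 * |t2 - t1| ^ r2)
    (h4 : ∀ s ∈ I01, ∀ t ∈ I01, |f s t| ≤ A4) :
    NN r1 r2 f ≤ ENNReal.ofReal (A1 + A2 + A3 + A4) := by
  rw [ENNReal.ofReal_add (by positivity) p4, ENNReal.ofReal_add (by positivity) p3,
    ENNReal.ofReal_add p1 p2]
  unfold NN
  refine add_le_add (add_le_add (add_le_add ?_ ?_) ?_) ?_
  · exact iSup_le fun s1 => iSup_le fun s2 => iSup_le fun t1 => iSup_le fun t2 =>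
      ENNReal.ofReal_le_ofReal
        (div_le_of_le_mul₀ (by positivity) p1 (h1 _ s1.2 _ s2.2 _ t1.2 _ t2.2))
  · exact iSup_le fun s1 => iSup_le fun s2 => iSup_le fun t =>
      ENNReal.ofReal_le_ofReal
        (div_le_of_le_mul₀ (by positivity) p2 (h2 _ s1.2 _ s2.2 _ t.2))
  · exact iSup_le fun s => iSup_le fun t1 => iSup_le fun t2 =>
      ENNReal.ofReal_le_ofReal
        (div_le_of_le_mul₀ (by positivity) p3 (h3 _ s.2 _ t1.2 _ t2.2))
  · exact iSup_le fun s => iSup_le fun t =>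
      ENNReal.ofReal_le_ofReal (h4 _ s.2 _ t.2)

lemma derivs_of_contDiff {f : ℝ → ℝ} (hf : ContDiff ℝ 3 f) (l : ℕ) (hl : l < 3) (x : ℝ) :
    HasDerivAt (iteratedDeriv l f) (iteratedDeriv (l + 1) f x) x := by
  rw [iteratedDeriv_succ]
  exact ((hf.differentiable_iteratedDeriv l (by exact_mod_cast hl)) x).hasDerivAt

theorem composition_estimate_exponential_growth
    (ρ1 ρ2 c lam : ℝ)
    (hρ1 : ρ1 ∈ Set.Ioo (0:ℝ) 1) (hρ2 : ρ2 ∈ Set.Ioo (0:ℝ) 1)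
    (hc : 0 < c) (hlam : 0 < lam) :
    ∃ C θ : ℝ, ∀ f : ℝ → ℝ, ContDiff ℝ 3 f →
      (∀ l : ℕ, l ≤ 3 → ∀ ξ : ℝ, |iteratedDeriv l f ξ| ≤ c * Real.exp (lam * ξ ^ 2)) →
      ∀ x1 x2 : ℝ → ℝ → ℝ,
        ContinuousOn (fun p : ℝ × ℝ => x1 p.1 p.2) (I01 ×ˢ I01) →
        ContinuousOn (fun p : ℝ × ℝ => x2 p.1 p.2) (I01 ×ˢ I01) →
        NN ρ1 ρ2 x1 ≠ ⊤ → NN ρ1 ρ2 x2 ≠ ⊤ →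
        NN ρ1 ρ2 (fun s t => f (x1 s t) - f (x2 s t)) ≤
          ENNReal.ofReal
              (C * Real.exp (θ * ((holInf x1).toReal ^ 2 + (holInf x2).toReal ^ 2))) *
            NN ρ1 ρ2 (fun s t => x1 s t - x2 s t) *
            (1 + NN ρ1 ρ2 x1 + NN ρ1 ρ2 x2) ^ 2 := by
  obtain ⟨r1, -⟩ := hρ1
  obtain ⟨r2, -⟩ := hρ2
  refine ⟨4 * c, lam, ?_⟩
  intro f hf hfb x1 x2 _ _ hx1 hx2
  have hE := Real.exp_pos (lam * ((holInf x1).toReal ^ 2 + (holInf x2).toReal ^ 2))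
  have hone : (1 : ℝ≥0∞) ≤ 1 + NN ρ1 ρ2 x1 + NN ρ1 ρ2 x2 := by
    rw [add_assoc]; exact le_self_add
  by_cases hD : NN ρ1 ρ2 (fun s t => x1 s t - x2 s t) = ⊤
  · rw [hD, ENNReal.mul_top (by
      rw [Ne, ENNReal.ofReal_eq_zero, not_le]; positivity), ENNReal.top_mul]
    · exact le_top
    · exact pow_ne_zero _ (fun h => by rw [h] at hone; simp at hone)
  obtain ⟨xa, xb, xc, -, xe⟩ := nn_bounds r1 r2 hx1
  obtain ⟨ya, yb, yc, -, ye⟩ := nn_bounds r1 r2 hx2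
  obtain ⟨da, db, dc, dd, -⟩ := nn_bounds r1 r2 hD
  rw [← ENNReal.ofReal_toReal hx1, ← ENNReal.ofReal_toReal hx2, ← ENNReal.ofReal_toReal hD,
    ← ENNReal.ofReal_one, ← ENNReal.ofReal_add (by simp) (by simp),
    ← ENNReal.ofReal_add (by positivity) (by simp), ← ENNReal.ofReal_pow (by positivity),
    ← ENNReal.ofReal_mul (by positivity), ← ENNReal.ofReal_mul (by positivity)]
  have hM1 : 0 ≤ (NN ρ1 ρ2 x1).toReal := by simp
  have hM2 : 0 ≤ (NN ρ1 ρ2 x2).toReal := by simp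
  have hN : 0 ≤ (NN ρ1 ρ2 (fun s t => x1 s t - x2 s t)).toReal := by simp
  generalize (NN ρ1 ρ2 x1).toReal = M1 at *
  generalize (NN ρ1 ρ2 x2).toReal = M2 at *
  generalize (NN ρ1 ρ2 (fun s t => x1 s t - x2 s t)).toReal = N at *
  have hA : 0 ≤ (holInf x1).toReal := by simp
  have hB : 0 ≤ (holInf x2).toReal := by simp
  generalize (holInf x1).toReal = A at *
  generalize (holInf x2).toReal = B at *
  obtain ⟨K, hK⟩ : ∃ K, K = c * Real.exp (lam * (A ^ 2 + B ^ 2)) := ⟨_, rfl⟩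
  obtain ⟨M, hM⟩ : ∃ M, M = M1 + M2 := ⟨_, rfl⟩
  have hM0 : 0 ≤ M := by rw [hM]; positivity
  have hK0 : 0 ≤ K := by rw [hK]; positivity
  have hbd : ∀ l : ℕ, l ≤ 3 → ∀ x, |x| ≤ max A B → |iteratedDeriv l f x| ≤ K := by
    intro l hl x hx
    refine (hfb l hl x).trans ?_
    rw [hK]
    have : x ^ 2 ≤ A ^ 2 + B ^ 2 := by
      rw [← sq_abs]
      rcases le_max_iff.1 hx with h | h <;> nlinarith [abs_nonneg x]
    gcongr
  have g0 := derivs_of_contDiff hf 0 (by norm_num)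
  have g1 := derivs_of_contDiff hf 1 (by norm_num)
  have g2 := derivs_of_contDiff hf 2 (by norm_num)
  rw [iteratedDeriv_zero] at g0
  have k1 := hbd 1 (by norm_num)
  have k2 := hbd 2 (by norm_num)
  have k3 := hbd 3 (by norm_num)
  have xR : ∀ s ∈ I01, ∀ t ∈ I01, |x1 s t| ≤ max A B :=
    fun s hs t ht => (xe s hs t ht).trans (le_max_left _ _)
  have yR : ∀ s ∈ I01, ∀ t ∈ I01, |x2 s t| ≤ max A B :=
    fun s hs t ht => (ye s hs t ht).trans (le_max_right _ _)
  have m1 : M1 ≤ M := by linarith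
  have m2 : M2 ≤ M := by linarith
  refine (nn_le (A1 := K * N * (1 + 3 * M + M ^ 2)) (A2 := K * N * (1 + M))
    (A3 := K * N * (1 + M)) (A4 := K * N) (by positivity) (by positivity) (by positivity)
    (by positivity) ?_ ?_ ?_ ?_).trans ?_
  · intro s1 hs1 s2 hs2 t1 ht1 t2 ht2
    have P0 : 0 ≤ |s2 - s1| ^ ρ1 := by positivity
    have Q0 : 0 ≤ |t2 - t1| ^ ρ2 := by positivity
    exact eight_pt hK0 hM0 hN P0 Q0 g0 g1 g2 k1 k2 k3
      (xR s1 hs1 t1 ht1) (xR s1 hs1 t2 ht2) (xR s2 hs2 t1 ht1) (xR s2 hs2 t2 ht2)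
      (yR s1 hs1 t1 ht1) (yR s1 hs1 t2 ht2) (yR s2 hs2 t1 ht1) (yR s2 hs2 t2 ht2)
      ((xb s1 hs1 s2 hs2 t1 ht1).trans (by gcongr))
      ((xc s2 hs2 t1 ht1 t2 ht2).trans (by gcongr))
      ((xc s1 hs1 t1 ht1 t2 ht2).trans (by gcongr))
      ((xa s1 hs1 s2 hs2 t1 ht1 t2 ht2).trans (by gcongr))
      ((yb s1 hs1 s2 hs2 t1 ht1).trans (by gcongr))
      ((yc s2 hs2 t1 ht1 t2 ht2).trans (by gcongr))
      ((yc s1 hs1 t1 ht1 t2 ht2).trans (by gcongr))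
      ((ya s1 hs1 s2 hs2 t1 ht1 t2 ht2).trans (by gcongr))
      (dd s2 hs2 t2 ht2) (db s1 hs1 s2 hs2 t2 ht2) (dc s2 hs2 t1 ht1 t2 ht2)
      (da s1 hs1 s2 hs2 t1 ht1 t2 ht2)
  · intro s1 hs1 s2 hs2 t ht
    have h := four_pt hK0 g0 g1 k1 k2 (xR s1 hs1 t ht) (xR s2 hs2 t ht) (yR s1 hs1 t ht)
      (yR s2 hs2 t ht) ((xb s1 hs1 s2 hs2 t ht).trans (mul_le_mul_of_nonneg_right m1 (by positivity)))
      ((yb s1 hs1 s2 hs2 t ht).trans (mul_le_mul_of_nonneg_right m2 (by positivity)))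
    have e1 := db s1 hs1 s2 hs2 t ht
    have e2 := dd s1 hs1 t ht
    unfold d1 at *
    rw [show x1 s2 t - x2 s2 t - x1 s1 t + x2 s1 t =
      x1 s2 t - x2 s2 t - (x1 s1 t - x2 s1 t) by ring] at h
    rw [show f (x1 s2 t) - f (x2 s2 t) - (f (x1 s1 t) - f (x2 s1 t)) =
      f (x1 s2 t) - f (x2 s2 t) - f (x1 s1 t) + f (x2 s1 t) by ring]
    calc _ ≤ _ := h
      _ ≤ K * (N * |s2 - s1| ^ ρ1) + K * (M * |s2 - s1| ^ ρ1) * N := by gcongr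
      _ = _ := by ring
  · intro s hs t1 ht1 t2 ht2
    have h := four_pt hK0 g0 g1 k1 k2 (xR s hs t1 ht1) (xR s hs t2 ht2) (yR s hs t1 ht1)
      (yR s hs t2 ht2) ((xc s hs t1 ht1 t2 ht2).trans (mul_le_mul_of_nonneg_right m1 (by positivity)))
      ((yc s hs t1 ht1 t2 ht2).trans (mul_le_mul_of_nonneg_right m2 (by positivity)))
    have e1 := dc s hs t1 ht1 t2 ht2
    have e2 := dd s hs t1 ht1
    unfold d2 at *
    rw [show x1 s t2 - x2 s t2 - x1 s t1 + x2 s t1 =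
      x1 s t2 - x2 s t2 - (x1 s t1 - x2 s t1) by ring] at h
    rw [show f (x1 s t2) - f (x2 s t2) - (f (x1 s t1) - f (x2 s t1)) =
      f (x1 s t2) - f (x2 s t2) - f (x1 s t1) + f (x2 s t1) by ring]
    calc _ ≤ _ := h
      _ ≤ K * (N * |t2 - t1| ^ ρ2) + K * (M * |t2 - t1| ^ ρ2) * N := by gcongr
      _ = _ := by ring
  · intro s hs t ht
    exact (lip_of_deriv g0 k1 (xR s hs t ht) (yR s hs t ht)).trans
      (mul_le_mul_of_nonneg_left (dd s hs t ht) hK0)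
  · apply ENNReal.ofReal_le_ofReal
    rw [show 4 * c * Real.exp (lam * (A ^ 2 + B ^ 2)) = 4 * K by rw [hK]; ring,
      show 1 + M1 + M2 = 1 + M by rw [hM]; ring]
    have hKN : 0 ≤ K * N := by positivity
    nlinarith [mul_nonneg hKN hM0, mul_nonneg hKN (sq_nonneg M)]
end
end
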